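/- arXiv:math/0506595 — 5 statements merged into one kernel-verified Lean document; each statement's English description precedes it below -/
import Mathlib

section
/- Let E be a Polish space (separable and completely metrizable, with a fixed complete metric) equipped with its Borel σ-algebra, let (Ω, F, P) be a probability space, and let (Z_n)_{n∈ℕ} be a sequence of measurable maps Z_n : Ω → E. Then there exists a measurable Z : Ω → E such that Z_n converges to Z in probability (i.e., for every ε > 0, P(dist(Z_n, Z) > ε) → 0 as n → ∞) if and only if for every pair of strictly increasing maps φ, ψ : ℕ → ℕ there exists a strictly increasing map ρ : ℕ → ℕ such that the laws of the pairs (Z_{φ(ρ(n))}, Z_{ψ(ρ(n))}) converge weakly, as n → ∞, to a probability measure μ on E × E with μ({(x, y) ∈ E × E : x = y}) = 1. -/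
open MeasureTheory Filter Topology

/-- A sequence of functions that is Cauchy in measure and takes values in a complete separable
metric space converges in measure to a measurable function. -/
theorem exists_measurable_tendstoInMeasure_of_cauchy
    {E : Type*} [MetricSpace E] [CompleteSpace E] [TopologicalSpace.SeparableSpace E]
    [MeasurableSpace E] [BorelSpace E]
    {Ω : Type*} [MeasurableSpace Ω] {P : Measure Ω} [IsFiniteMeasure P]
    {Z : ℕ → Ω → E} (hZ : ∀ n, Measurable (Z n))
    (hC : ∀ ε : ℝ, 0 < ε →
      Tendsto (fun p : ℕ × ℕ => P {ω | ε ≤ dist (Z p.1 ω) (Z p.2 ω)}) atTop (𝓝 0)) :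
    ∃ Zlim : Ω → E, Measurable Zlim ∧ TendstoInMeasure P Z atTop Zlim := by
  have : SecondCountableTopology E := UniformSpace.secondCountable_of_separable E
  have hsmall (k : ℕ) : ∀ᶠ n in atTop, ∀ m, n ≤ m →
      P {ω | (1 / 2 : ℝ) ^ k ≤ dist (Z n ω) (Z m ω)} ≤ (1 / 2 : ENNReal) ^ k := by
    have h := (hC ((1 / 2) ^ k) (by positivity)).eventually_le_const
      (show (0 : ENNReal) < (1 / 2) ^ k by
        apply ENNReal.pow_pos; simp)
    obtain ⟨N, hN⟩ := eventually_atTop.1 h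
    filter_upwards [eventually_ge_atTop (max N.1 N.2)] with n hn m hm
    exact hN (n, m) ⟨(le_max_left _ _).trans hn, (le_max_right _ _).trans (hn.trans hm)⟩
  obtain ⟨σ, hσ, hσP⟩ := extraction_forall_of_eventually hsmall
  have hae : ∀ᵐ ω ∂P, ∃ l, Tendsto (fun k => Z (σ k) ω) atTop (𝓝 l) := by
    have hsum : ∑' k, P {ω | (1 / 2 : ℝ) ^ k ≤ dist (Z (σ k) ω) (Z (σ (k + 1)) ω)} ≠ ⊤ := by
      refine ne_top_of_le_ne_top ?_
        (ENNReal.tsum_le_tsum fun k => hσP k (σ (k + 1)) (hσ.monotone k.le_succ))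
      rw [ENNReal.tsum_geometric]
      simp
    filter_upwards [ae_eventually_notMem hsum] with ω hω
    refine cauchySeq_tendsto_of_complete (cauchySeq_of_summable_dist ?_)
    refine summable_geometric_two.of_norm_bounded_eventually_nat ?_
    filter_upwards [hω] with k hk
    rw [Real.norm_of_nonneg dist_nonneg]
    exact (not_le.1 hk).le
  obtain ⟨Y, hY, hYlim⟩ :=
    measurable_limit_of_tendsto_metrizable_ae (fun k => (hZ (σ k)).aemeasurable) hae
  refine ⟨Y, hY, tendstoInMeasure_iff_dist.2 fun ε hε => ?_⟩
  have hσY := tendstoInMeasure_iff_dist.1 (tendstoInMeasure_of_tendsto_ae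
    (fun k => (hZ (σ k)).aestronglyMeasurable) hYlim) (ε / 2) (half_pos hε)
  have hZσ : Tendsto (fun n => P {ω | ε / 2 ≤ dist (Z n ω) (Z (σ n) ω)}) atTop (𝓝 0) :=
    (hC (ε / 2) (half_pos hε)).comp (f := fun n => (n, σ n))
      (by rw [← prod_atTop_atTop_eq]; exact tendsto_id.prodMk hσ.tendsto_atTop)
  refine tendsto_of_tendsto_of_tendsto_of_le_of_le tendsto_const_nhds
    (by simpa using hZσ.add hσY) (fun _ => zero_le) fun n => ?_
  refine (measure_mono fun ω hω => ?_).trans (measure_union_le _ _)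
  by_contra h
  simp only [Set.mem_union, Set.mem_ofPred_eq, not_or, not_le] at h hω
  linarith [dist_triangle (Z n ω) (Z (σ n) ω) (Y ω)]

/-- If the laws of the pairs `(X n, Y n)` converge weakly to a probability measure carried by the
diagonal, then `dist (X n) (Y n)` tends to zero in probability. -/
theorem tendsto_measure_le_dist_of_map_prod_tendsto_diagonal
    {E : Type*} [MetricSpace E] [TopologicalSpace.SeparableSpace E]
    [MeasurableSpace E] [BorelSpace E]
    {Ω : Type*} [MeasurableSpace Ω] {P : Measure Ω} [IsProbabilityMeasure P]
    {X Y : ℕ → Ω → E} (hX : ∀ n, Measurable (X n)) (hY : ∀ n, Measurable (Y n))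
    {μ : Measure (E × E)} [IsProbabilityMeasure μ] (hμ : μ {p : E × E | p.1 = p.2} = 1)
    (h : ∀ g : BoundedContinuousFunction (E × E) ℝ,
      Tendsto (fun n => ∫ p, g p ∂(P.map (fun ω => (X n ω, Y n ω)))) atTop (𝓝 (∫ p, g p ∂μ)))
    {ε : ℝ} (hε : 0 < ε) :
    Tendsto (fun n => P {ω | ε ≤ dist (X n ω) (Y n ω)}) atTop (𝓝 0) := by
  have : SecondCountableTopology E := UniformSpace.secondCountable_of_separable E
  have hXY (n : ℕ) : Measurable fun ω => (X n ω, Y n ω) := (hX n).prodMk (hY n)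
  let ν : ℕ → ProbabilityMeasure (E × E) := fun n =>
    ⟨P.map fun ω => (X n ω, Y n ω), Measure.isProbabilityMeasure_map (hXY n).aemeasurable⟩
  have hν : Tendsto ν atTop (𝓝 ⟨μ, inferInstance⟩) :=
    ProbabilityMeasure.tendsto_iff_forall_integral_tendsto.2 h
  have hF : IsClosed {p : E × E | ε ≤ dist p.1 p.2} :=
    isClosed_le continuous_const (continuous_fst.dist continuous_snd)
  have hμF : μ {p : E × E | ε ≤ dist p.1 p.2} = 0 := by
    have hdiag : MeasurableSet {p : E × E | p.1 = p.2} :=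
      (isClosed_eq continuous_fst continuous_snd).measurableSet
    refine measure_mono_null ?_ ((prob_compl_eq_zero_iff hdiag).2 hμ)
    intro p hp hpq
    have hp' : ε ≤ dist p.1 p.2 := hp
    have hpq' : p.1 = p.2 := hpq
    rw [hpq', dist_self] at hp'
    exact hp'.not_gt hε
  have hlim := ProbabilityMeasure.limsup_measure_closed_le_of_tendsto hν hF
  refine tendsto_of_le_liminf_of_limsup_le zero_le ?_
  refine (le_of_eq ?_).trans (hlim.trans hμF.le)
  congr with n
  exact (Measure.map_apply (hXY n) hF.measurableSet).symm

/-- **Gyöngy–Krylov criterion.** Let `E` be a Polish space with its Borel σ-algebra, and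
`(Z n)` a sequence of measurable maps from a probability space to `E`.  Then `Z n` converges
in probability to some measurable `Z` iff every pair of subsequences admits a further
(joint) subsequence whose pair laws converge weakly to a probability measure supported on
the diagonal of `E × E`. -/
theorem gyongy_krylov_convergence_in_probability
    {E : Type*} [MetricSpace E] [CompleteSpace E] [TopologicalSpace.SeparableSpace E]
    [MeasurableSpace E] [BorelSpace E]
    {Ω : Type*} [MeasurableSpace Ω] (P : Measure Ω) [IsProbabilityMeasure P]
    (Z : ℕ → Ω → E) (hZ : ∀ n, Measurable (Z n)) :
    (∃ Zlim : Ω → E, Measurable Zlim ∧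
        ∀ ε : ℝ, 0 < ε →
          Tendsto (fun n => P {ω | ε < dist (Z n ω) (Zlim ω)}) atTop (𝓝 0)) ↔
      (∀ φ ψ : ℕ → ℕ, StrictMono φ → StrictMono ψ →
        ∃ ρ : ℕ → ℕ, StrictMono ρ ∧
          ∃ μ : Measure (E × E), IsProbabilityMeasure μ ∧
            μ {p : E × E | p.1 = p.2} = 1 ∧
            ∀ g : BoundedContinuousFunction (E × E) ℝ,
              Tendsto
                (fun n => ∫ p, g p ∂(P.map (fun ω => (Z (φ (ρ n)) ω, Z (ψ (ρ n)) ω))))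
                atTop (𝓝 (∫ p, g p ∂μ))) := by
  have : SecondCountableTopology E := UniformSpace.secondCountable_of_separable E
  constructor
  · rintro ⟨Y, hY, h⟩ φ ψ hφ hψ
    have hlim : TendstoInMeasure P Z atTop Y := by
      refine tendstoInMeasure_iff_dist.2 fun ε hε => ?_
      refine tendsto_of_tendsto_of_tendsto_of_le_of_le tendsto_const_nhds
        (h (ε / 2) (half_pos hε)) (fun _ => zero_le) fun n => measure_mono fun ω hω => ?_
      exact (half_lt_self hε).trans_le hω
    obtain ⟨σ, hσ, hσY⟩ := (hlim.comp hφ.tendsto_atTop).exists_seq_tendsto_ae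
    obtain ⟨τ, hτ, hτY⟩ :=
      (hlim.comp (hψ.comp hσ).tendsto_atTop).exists_seq_tendsto_ae
    have hYY : Measurable fun ω => (Y ω, Y ω) := hY.prodMk hY
    refine ⟨σ ∘ τ, hσ.comp hτ, P.map fun ω => (Y ω, Y ω),
      Measure.isProbabilityMeasure_map hYY.aemeasurable, ?_, fun g => ?_⟩
    · rw [Measure.map_apply hYY (isClosed_eq continuous_fst continuous_snd).measurableSet]
      simp
    · have hg := g.continuous
      have hpair (n : ℕ) : Measurable fun ω =>
          (Z (φ ((σ ∘ τ) n)) ω, Z (ψ ((σ ∘ τ) n)) ω) := (hZ _).prodMk (hZ _)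
      rw [integral_map hYY.aemeasurable hg.aestronglyMeasurable]
      simp_rw [fun n => integral_map (μ := P) (hpair n).aemeasurable hg.aestronglyMeasurable]
      refine tendsto_integral_of_dominated_convergence (fun _ => ‖g‖)
        (fun n => (hg.measurable.comp (hpair n)).aestronglyMeasurable) (integrable_const _)
        (fun n => ae_of_all _ fun ω => g.norm_coe_le_norm _) ?_
      filter_upwards [hσY, hτY] with ω h₁ h₂
      exact (hg.tendsto _).comp ((h₁.comp hτ.tendsto_atTop).prodMk_nhds h₂)
  · intro h
    obtain ⟨Y, hY, hlim⟩ := exists_measurable_tendstoInMeasure_of_cauchy (P := P) hZ fun ε hε => by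
      refine tendsto_of_subseq_tendsto fun u hu => ?_
      rw [← prod_atTop_atTop_eq, tendsto_prod_iff'] at hu
      obtain ⟨σ, hσ, hφ⟩ := strictMono_subseq_of_tendsto_atTop hu.1
      obtain ⟨τ, hτ, hψ⟩ :=
        strictMono_subseq_of_tendsto_atTop (hu.2.comp hσ.tendsto_atTop)
      obtain ⟨ρ, -, μ, hμ, hdiag, hweak⟩ := h _ _ (hφ.comp hτ) hψ
      exact ⟨fun n => σ (τ (ρ n)), tendsto_measure_le_dist_of_map_prod_tendsto_diagonal
        (fun _ => hZ _) (fun _ => hZ _) hdiag hweak hε⟩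
    refine ⟨Y, hY, fun ε hε => ?_⟩
    exact tendsto_of_tendsto_of_tendsto_of_le_of_le tendsto_const_nhds
      (tendstoInMeasure_iff_dist.1 hlim ε hε) (fun _ => zero_le)
      fun n => measure_mono fun ω (hω : ε < dist (Z n ω) (Y ω)) => hω.le
end

section
/- Let d ≥ 1 be an integer and σ > 0 a real number. For every u ∈ 𝒮(ℝ^d; ℂ) one has −2 Re ∫_{ℝ^d} (x·∇ū(x)) (Δu(x) + |u(x)|^{2σ} u(x)) dx − d · Re ∫_{ℝ^d} ū(x) (Δu(x) + |u(x)|^{2σ} u(x)) dx = 2 ∫_{ℝ^d} |∇u(x)|² dx − (σ d/(σ+1)) ∫_{ℝ^d} |u(x)|^{2σ+2} dx. -/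
open MeasureTheory Complex Filter Topology

noncomputable section

variable {d : ℕ}

/-- The `k`-th partial derivative of a function `u : ℝ^d → ℂ`. -/
def pd (u : EuclideanSpace ℝ (Fin d) → ℂ) (k : Fin d) (x : EuclideanSpace ℝ (Fin d)) : ℂ :=
  fderiv ℝ u x (EuclideanSpace.single k 1)

/-- The second partial derivative `∂_j ∂_k u` of a function `u : ℝ^d → ℂ`. -/
def pd2 (u : EuclideanSpace ℝ (Fin d) → ℂ) (j k : Fin d) (x : EuclideanSpace ℝ (Fin d)) : ℂ :=
  fderiv ℝ (fun y => fderiv ℝ u y (EuclideanSpace.single k 1)) x (EuclideanSpace.single j 1)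

/-- The Laplacian of a function `u : ℝ^d → ℂ`. -/
def lap (u : EuclideanSpace ℝ (Fin d) → ℂ) (x : EuclideanSpace ℝ (Fin d)) : ℂ :=
  ∑ k, pd2 u k k x

open scoped SchwartzMap LineDeriv RealInnerProductSpace

namespace SchwartzMap

/-- Multiplication of a Schwartz function by the `k`-th coordinate. -/
def coordMul (k : Fin d) :
    𝓢(EuclideanSpace ℝ (Fin d), ℂ) →L[ℝ] 𝓢(EuclideanSpace ℝ (Fin d), ℂ) :=
  smulLeftCLM ℂ fun x : EuclideanSpace ℝ (Fin d) => x k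

variable (k j : Fin d) (f g : 𝓢(EuclideanSpace ℝ (Fin d), ℂ))

@[simp]
theorem coordMul_apply (x : EuclideanSpace ℝ (Fin d)) : coordMul k f x = x k • f x :=
  smulLeftCLM_apply_apply
    (EuclideanSpace.proj k : EuclideanSpace ℝ (Fin d) →L[ℝ] ℝ).hasTemperateGrowth f x

theorem lineDerivOp_coordMul (x : EuclideanSpace ℝ (Fin d)) :
    ∂_{EuclideanSpace.single j (1 : ℝ)} (coordMul k f) x =
      (if j = k then f x else 0) + x k • ∂_{EuclideanSpace.single j (1 : ℝ)} f x := by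
  have hk := (EuclideanSpace.proj k : EuclideanSpace ℝ (Fin d) →L[ℝ] ℝ).hasFDerivAt (x := x)
  have h := hk.fun_smul (f.hasFDerivAt x)
  have he : (coordMul k f : EuclideanSpace ℝ (Fin d) → ℂ) =
      fun y => (EuclideanSpace.proj k : EuclideanSpace ℝ (Fin d) →L[ℝ] ℝ) y • f y := by
    ext y; simp
  rw [lineDerivOp_apply_eq_fderiv, lineDerivOp_apply_eq_fderiv, he]
  rw [h.fderiv]
  by_cases hjk : j = k
  · subst hjk; simp [add_comm]
  · simp [hjk, Ne.symm hjk]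

theorem lineDerivOp_comm (v w : EuclideanSpace ℝ (Fin d)) : ∂_{v} (∂_{w} f) = ∂_{w} (∂_{v} f) := by
  ext x
  have h : ∀ a b : EuclideanSpace ℝ (Fin d),
      ∂_{a} (∂_{b} f) x = fderiv ℝ (fderiv ℝ f) x a b := by
    intro a b
    have hd : DifferentiableAt ℝ (fderiv ℝ f) x := (fderivCLM ℝ _ _ f).differentiableAt
    change fderiv ℝ (fun y => fderiv ℝ f y b) x a = _
    rw [fderiv_clm_apply hd (differentiableAt_const b)]
    simp
  rw [h, h]
  exact ((f.contDiffAt 2).isSymmSndFDerivAt (by simp)) v w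

theorem integrable_inner : Integrable (fun x => ⟪f x, g x⟫) :=
  (pairing (innerSL ℝ) f g).integrable

theorem integrable_norm_rpow_mul_inner {s : ℝ} (hs : 0 ≤ s)
    (u : 𝓢(EuclideanSpace ℝ (Fin d), ℂ)) : Integrable (fun x => ‖u x‖ ^ s * ⟪f x, g x⟫) := by
  refine (integrable_inner f g).bdd_mul (c := (SchwartzMap.seminorm ℝ 0 0 u) ^ s)
    (u.continuous.norm.rpow_const fun _ => Or.inr hs).aestronglyMeasurable (.of_forall fun x => ?_)
  rw [Real.norm_of_nonneg (by positivity)]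
  exact Real.rpow_le_rpow (norm_nonneg _) (norm_le_seminorm ℝ u x) hs

theorem integral_inner_lineDerivOp (v : EuclideanSpace ℝ (Fin d)) :
    ∫ x, ⟪f x, ∂_{v} g x⟫ = -∫ x, ⟪∂_{v} f x, g x⟫ :=
  integral_bilinear_lineDerivOp_right_eq_neg_left f g (innerSL ℝ) v

theorem integral_inner_coordMul_lineDerivOp :
    ∫ x, ⟪coordMul k f x, ∂_{EuclideanSpace.single j (1 : ℝ)} g x⟫ =
      -(if j = k then ∫ x, ⟪f x, g x⟫ else 0)
        - ∫ x, ⟪coordMul k (∂_{EuclideanSpace.single j (1 : ℝ)} f) x, g x⟫ := by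
  rw [integral_inner_lineDerivOp]
  simp_rw [lineDerivOp_coordMul, inner_add_left, ← coordMul_apply]
  split_ifs
  · rw [integral_add (integrable_inner _ _) (integrable_inner _ _)]
    ring
  · simp

theorem integral_inner_coordMul_lineDerivOp_self :
    ∫ x, ⟪coordMul k (∂_{EuclideanSpace.single k (1 : ℝ)} f) x, f x⟫ =
      -(1 / 2) * ∫ x, ‖f x‖ ^ 2 := by
  have h := integral_inner_coordMul_lineDerivOp k k f f
  have hs : ∫ x, ⟪coordMul k f x, ∂_{EuclideanSpace.single k (1 : ℝ)} f x⟫ =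
      ∫ x, ⟪coordMul k (∂_{EuclideanSpace.single k (1 : ℝ)} f) x, f x⟫ := by
    congr 1 with x
    rw [coordMul_apply, coordMul_apply, real_inner_smul_left, real_inner_smul_left,
      real_inner_comm]
  simp only [if_true, real_inner_self_eq_norm_sq] at h
  linarith

theorem integral_inner_coordMul_lineDerivOp_lineDerivOp :
    ∫ x, ⟪coordMul k (∂_{EuclideanSpace.single k (1 : ℝ)} f) x,
        ∂_{EuclideanSpace.single j (1 : ℝ)} (∂_{EuclideanSpace.single j (1 : ℝ)} f) x⟫ =
      (if j = k then -∫ x, ‖∂_{EuclideanSpace.single j (1 : ℝ)} f x‖ ^ 2 else 0)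
        + 1 / 2 * ∫ x, ‖∂_{EuclideanSpace.single j (1 : ℝ)} f x‖ ^ 2 := by
  rw [integral_inner_coordMul_lineDerivOp, lineDerivOp_comm,
    integral_inner_coordMul_lineDerivOp_self]
  split_ifs with h
  · subst h
    simp only [real_inner_self_eq_norm_sq]
    ring
  · ring

theorem integral_norm_rpow_mul_inner_coordMul_lineDerivOp {σ : ℝ} (hσ : 0 < σ) :
    ∫ x, ‖f x‖ ^ (2 * σ) * ⟪coordMul k (∂_{EuclideanSpace.single k (1 : ℝ)} f) x, f x⟫ =
      -(1 / (2 * σ + 2)) * ∫ x, ‖f x‖ ^ (2 * σ + 2) := by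
  have hN : ∀ x, ‖f x‖ ^ (2 * σ + 2) = ‖f x‖ ^ (2 * σ) * ⟪f x, f x⟫ := fun x => by
    rw [real_inner_self_eq_norm_sq, Real.rpow_add_of_nonneg (norm_nonneg _) (by positivity)
      (by norm_num), Real.rpow_two]
  have hI := integrable_norm_rpow_mul_inner
    (coordMul k (∂_{EuclideanSpace.single k (1 : ℝ)} f)) f (by positivity : 0 ≤ 2 * σ) f
  have hxk : ∀ x, HasFDerivAt (fun y : EuclideanSpace ℝ (Fin d) => y k)
      (EuclideanSpace.proj k : EuclideanSpace ℝ (Fin d) →L[ℝ] ℝ) x := fun x =>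
    (EuclideanSpace.proj k : EuclideanSpace ℝ (Fin d) →L[ℝ] ℝ).hasFDerivAt
  have hg : ∀ x, HasFDerivAt (fun y => ‖f y‖ ^ (2 * σ + 2))
      (((2 * σ + 2) * ‖f x‖ ^ (2 * σ + 2 - 2)) • (innerSL ℝ (f x)).comp (fderiv ℝ f x)) x :=
    fun x => (hasFDerivAt_norm_rpow (f x) (by linarith)).comp x (f.hasFDerivAt x)
  have hg' : ∀ x, x k * (((2 * σ + 2) * ‖f x‖ ^ (2 * σ + 2 - 2)) •
      (innerSL ℝ (f x)).comp (fderiv ℝ f x)) (EuclideanSpace.single k (1 : ℝ)) =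
      (2 * σ + 2) *
        (‖f x‖ ^ (2 * σ) * ⟪coordMul k (∂_{EuclideanSpace.single k (1 : ℝ)} f) x, f x⟫) := by
    intro x
    simp only [coordMul_apply, real_inner_smul_left, lineDerivOp_apply_eq_fderiv,
      add_sub_cancel_right, smul_apply, ContinuousLinearMap.comp_apply,
      innerSL_apply_apply, smul_eq_mul]
    rw [real_inner_comm]
    ring
  have key := integral_bilinear_hasFDerivAt_right_eq_neg_left_of_integrable
    (μ := (volume : Measure (EuclideanSpace ℝ (Fin d))))
    (B := ContinuousLinearMap.mul ℝ ℝ) (v := EuclideanSpace.single k (1 : ℝ))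
    (f := fun y : EuclideanSpace ℝ (Fin d) => y k) (g := fun y => ‖f y‖ ^ (2 * σ + 2))
    (f' := fun _ => EuclideanSpace.proj k)
    ?_ ?_ ?_ (fun x _ => hxk x) (fun x _ => hg x)
  · simp only [ContinuousLinearMap.mul_apply', hg', integral_const_mul] at key
    simp only [PiLp.proj_apply, PiLp.single_apply, if_true, one_mul] at key
    rw [neg_mul, one_div, eq_neg_iff_add_eq_zero, ← mul_right_inj' (by positivity : 2 * σ + 2 ≠ 0),
      mul_add, key, mul_inv_cancel_left₀ (by positivity)]
    simp
  · simpa [hN] using integrable_norm_rpow_mul_inner f f (by positivity : 0 ≤ 2 * σ) f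
  · simp only [ContinuousLinearMap.mul_apply', hg']
    exact hI.const_mul _
  · simp only [ContinuousLinearMap.mul_apply', hN]
    refine (integrable_norm_rpow_mul_inner (coordMul k f) f (by positivity : 0 ≤ 2 * σ) f).congr
      (.of_forall fun x => ?_)
    simp only [coordMul_apply, real_inner_smul_left]
    ring

theorem integrable_conj_mul_norm_rpow_mul {s : ℝ} (hs : 0 ≤ s)
    (u : 𝓢(EuclideanSpace ℝ (Fin d), ℂ)) :
    Integrable fun x => (starRingEnd ℂ) (f x) * (((‖u x‖ ^ s : ℝ) : ℂ) * g x) := by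
  have hb : Integrable fun x => ((‖u x‖ ^ s : ℝ) : ℂ) * ((starRingEnd ℂ) (f x) * g x) := by
    refine (pairing (ContinuousLinearMap.mul ℝ ℂ)
      (f.postcompCLM (conjCLE : ℂ →L[ℝ] ℂ)) g).integrable.bdd_mul
      (c := (SchwartzMap.seminorm ℝ 0 0 u) ^ s)
      (continuous_ofReal.comp
        (u.continuous.norm.rpow_const fun _ => Or.inr hs)).aestronglyMeasurable
      (.of_forall fun x => ?_)
    rw [norm_real, Real.norm_of_nonneg (by positivity)]
    exact Real.rpow_le_rpow (norm_nonneg _) (norm_le_seminorm ℝ u x) hs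
  exact hb.congr (.of_forall fun x => by ring)

theorem re_integral_conj_mul_add_norm_rpow_mul {s : ℝ} (hs : 0 ≤ s)
    (u : 𝓢(EuclideanSpace ℝ (Fin d), ℂ)) :
    (∫ x, (starRingEnd ℂ) (f x) * (g x + ((‖u x‖ ^ s : ℝ) : ℂ) * u x)).re =
      (∫ x, ⟪f x, g x⟫) + ∫ x, ‖u x‖ ^ s * ⟪f x, u x⟫ := by
  have h1 : Integrable fun x => (starRingEnd ℂ) (f x) * g x :=
    (pairing (ContinuousLinearMap.mul ℝ ℂ) (f.postcompCLM (conjCLE : ℂ →L[ℝ] ℂ)) g).integrable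
  have h2 := integrable_conj_mul_norm_rpow_mul f u hs u
  rw [← integral_add (integrable_inner _ _) (integrable_norm_rpow_mul_inner _ _ hs _)]
  simp only [mul_add]
  refine (integral_re (h1.add h2)).symm.trans (integral_congr_ae (.of_forall fun x => ?_))
  simp only [Complex.inner, RCLike.re_eq_complex_re, add_re, Pi.add_apply]
  rw [← re_ofReal_mul]
  congr 2 <;> ring

end SchwartzMap

open SchwartzMap

/-- The integration-by-parts identity underlying the evolution of the momentum `G` in the
variance identity (proof of Proposition 3.2, Section 6.1):
`−2 Re ∫ (x·∇ū)(Δu + |u|^{2σ}u) dx − d Re ∫ ū (Δu + |u|^{2σ}u) dx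
  = 2 ∫ |∇u|² dx − (σd/(σ+1)) ∫ |u|^{2σ+2} dx`. -/
theorem momentum_integration_by_parts (hd : 1 ≤ d) {σ : ℝ} (hσ : 0 < σ)
    (u : SchwartzMap (EuclideanSpace ℝ (Fin d)) ℂ) :
    -2 * (∫ x, (∑ k, (x k : ℂ) * (starRingEnd ℂ) (pd (⇑u) k x)) *
            (lap (⇑u) x + ((‖u x‖ ^ (2 * σ) : ℝ) : ℂ) * u x)).re
      - (d : ℝ) * (∫ x, (starRingEnd ℂ) (u x) *
            (lap (⇑u) x + ((‖u x‖ ^ (2 * σ) : ℝ) : ℂ) * u x)).re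
      = 2 * (∫ x, ∑ k, ‖pd (⇑u) k x‖ ^ 2)
          - (σ * d / (σ + 1)) * ∫ x, ‖u x‖ ^ (2 * σ + 2) := by
  have hs : 0 ≤ 2 * σ := by positivity
  set e : Fin d → EuclideanSpace ℝ (Fin d) := fun k => EuclideanSpace.single k (1 : ℝ) with he
  set L : 𝓢(EuclideanSpace ℝ (Fin d), ℂ) := ∑ j, ∂_{e j} (∂_{e j} u) with hL
  set P : 𝓢(EuclideanSpace ℝ (Fin d), ℂ) := ∑ k, coordMul k (∂_{e k} u) with hP
  set S : Fin d → ℝ := fun j => ∫ x, ‖∂_{e j} u x‖ ^ 2 with hS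
  set M : ℝ := ∫ x, ‖u x‖ ^ (2 * σ + 2) with hM
  have hLx : ∀ x, L x = ∑ j, ∂_{e j} (∂_{e j} u) x := fun x => by simp [hL, sum_apply]
  have hPx : ∀ x, P x = ∑ k, coordMul k (∂_{e k} u) x := fun x => by simp [hP, sum_apply]
  have hlap : ∀ x, lap u x = L x := fun x => (hLx x).symm
  have hgrad : ∀ x, ∑ k, (x k : ℂ) * (starRingEnd ℂ) (pd u k x) = (starRingEnd ℂ) (P x) := by
    intro x
    simp only [hPx, map_sum, coordMul_apply, real_smul, map_mul, conj_ofReal]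
    rfl
  have hPL : ∫ x, ⟪P x, L x⟫ = ∑ k, ∑ j, ((if j = k then -S j else 0) + 1 / 2 * S j) := by
    simp only [hPx, hLx, sum_inner]
    simp only [inner_sum]
    rw [integral_finsetSum _ fun _ _ => integrable_finsetSum _ fun _ _ => integrable_inner _ _]
    refine Finset.sum_congr rfl fun k _ => ?_
    rw [integral_finsetSum _ fun _ _ => integrable_inner _ _]
    exact Finset.sum_congr rfl fun j _ => integral_inner_coordMul_lineDerivOp_lineDerivOp k j u
  have hPu : ∫ x, ‖u x‖ ^ (2 * σ) * ⟪P x, u x⟫ = d * (-(1 / (2 * σ + 2)) * M) := by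
    simp only [hPx, sum_inner, Finset.mul_sum]
    rw [integral_finsetSum _ fun _ _ => integrable_norm_rpow_mul_inner _ _ hs _]
    simp only [he, integral_norm_rpow_mul_inner_coordMul_lineDerivOp _ u hσ, ← hM]
    simp
  have huL : ∫ x, ⟪u x, L x⟫ = -∑ j, S j := by
    simp only [hLx, inner_sum]
    rw [integral_finsetSum _ fun _ _ => integrable_inner _ _]
    simp only [integral_inner_lineDerivOp, real_inner_self_eq_norm_sq, Finset.sum_neg_distrib, hS]
  have huu : ∫ x, ‖u x‖ ^ (2 * σ) * ⟪u x, u x⟫ = M := by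
    refine integral_congr_ae (.of_forall fun x => ?_)
    simp only [real_inner_self_eq_norm_sq]
    rw [Real.rpow_add_of_nonneg (norm_nonneg _) hs (by norm_num), Real.rpow_two]
  have hgrad2 : ∫ x, ∑ k, ‖pd u k x‖ ^ 2 = ∑ j, S j := by
    refine integral_finsetSum _ fun k _ => ?_
    have h := integrable_inner (∂_{e k} u) (∂_{e k} u)
    simp only [real_inner_self_eq_norm_sq] at h
    exact h
  simp only [hlap, hgrad]
  rw [re_integral_conj_mul_add_norm_rpow_mul P L hs u,
    re_integral_conj_mul_add_norm_rpow_mul u L hs u, hPL, hPu, huL, huu, hgrad2]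
  simp only [Finset.sum_add_distrib, Finset.sum_ite_eq', Finset.mem_univ, if_true,
    Finset.sum_neg_distrib, Finset.sum_const, Finset.card_univ, Fintype.card_fin, nsmul_eq_mul,
    ← Finset.mul_sum]
  field_simp
  ring
end
end

section
/- Let d ≥ 1 be an integer. For every u ∈ 𝒮(ℝ^d; ℂ) one has ∫_{ℝ^d} |x·∇u(x)|² dx ≤ (d(d+1)/2) ∫_{ℝ^d} |u(x)|² dx + (∫_{ℝ^d} |x|⁴ |u(x)|² dx)^{1/2} (∫_{ℝ^d} ‖D²u(x)‖² dx)^{1/2}, where ‖D²u(x)‖ denotes the Hilbert–Schmidt (Frobenius) norm of the Hessian of u at x, ‖D²u(x)‖² = Σ_{j,k=1}^d |∂_j∂_k u(x)|². -/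
open MeasureTheory Complex Filter Topology

noncomputable section

variable {d : ℕ}

open scoped SchwartzMap LineDeriv InnerProductSpace

/-- The radial derivative `x · ∇f` of a Schwartz function, as a Schwartz function. -/
def radialDeriv (f : 𝓢(EuclideanSpace ℝ (Fin d), ℂ)) : 𝓢(EuclideanSpace ℝ (Fin d), ℂ) :=
  ∑ k, SchwartzMap.smulLeftCLM ℂ (fun x : EuclideanSpace ℝ (Fin d) => x k)
    (∂_{EuclideanSpace.single k (1 : ℝ)} f)

lemma hasTemperateGrowth_coord (k : Fin d) :
    (fun x : EuclideanSpace ℝ (Fin d) => x k).HasTemperateGrowth :=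
  (EuclideanSpace.proj k : EuclideanSpace ℝ (Fin d) →L[ℝ] ℝ).hasTemperateGrowth

lemma radialDeriv_apply (f : 𝓢(EuclideanSpace ℝ (Fin d), ℂ)) (x : EuclideanSpace ℝ (Fin d)) :
    radialDeriv f x = ∑ k, x k • (∂_{EuclideanSpace.single k (1 : ℝ)} f) x := by
  simp [radialDeriv,
    SchwartzMap.smulLeftCLM_apply_apply (hasTemperateGrowth_coord _)]

lemma lineDeriv_coord_smul (f : 𝓢(EuclideanSpace ℝ (Fin d), ℂ)) (j k : Fin d)
    (x : EuclideanSpace ℝ (Fin d)) :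
    (∂_{EuclideanSpace.single j (1 : ℝ)}
      (SchwartzMap.smulLeftCLM ℂ (fun x : EuclideanSpace ℝ (Fin d) => x k) f)) x =
      (if j = k then f x else 0) + x k • (∂_{EuclideanSpace.single j (1 : ℝ)} f) x := by
  have hc : HasFDerivAt (fun x : EuclideanSpace ℝ (Fin d) => x k)
      (EuclideanSpace.proj k : EuclideanSpace ℝ (Fin d) →L[ℝ] ℝ) x :=
    (EuclideanSpace.proj k : EuclideanSpace ℝ (Fin d) →L[ℝ] ℝ).hasFDerivAt
  rw [SchwartzMap.lineDerivOp_apply_eq_fderiv, SchwartzMap.lineDerivOp_apply_eq_fderiv,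
    SchwartzMap.smulLeftCLM_apply (hasTemperateGrowth_coord k),
    (hc.fun_smul (f.hasFDerivAt x)).fderiv]
  by_cases h : j = k
  · simp [h, add_comm]
  · simp [h, Ne.symm h]

lemma integrable_inner_schwartz (f g : 𝓢(EuclideanSpace ℝ (Fin d), ℂ)) :
    Integrable (fun x => ⟪f x, g x⟫_ℝ) :=
  (SchwartzMap.pairing (innerSL ℝ) f g).integrable

/-- The adjoint of the radial derivative is `-(x · ∇) - d`. -/
lemma integral_inner_radialDeriv (f g : 𝓢(EuclideanSpace ℝ (Fin d), ℂ)) :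
    ∫ x, ⟪f x, radialDeriv g x⟫_ℝ =
      -(∫ x, ⟪radialDeriv f x, g x⟫_ℝ) - d * ∫ x, ⟪f x, g x⟫_ℝ := by
  set X : Fin d → 𝓢(EuclideanSpace ℝ (Fin d), ℂ) → 𝓢(EuclideanSpace ℝ (Fin d), ℂ) :=
    fun k => SchwartzMap.smulLeftCLM ℂ (fun x : EuclideanSpace ℝ (Fin d) => x k) with hX
  have hXa (k : Fin d) (h : 𝓢(EuclideanSpace ℝ (Fin d), ℂ)) (x) : X k h x = x k • h x :=
    SchwartzMap.smulLeftCLM_apply_apply (hasTemperateGrowth_coord k) h x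
  have hparts (k : Fin d) :
      ∫ x, ⟪X k f x, (∂_{EuclideanSpace.single k (1 : ℝ)} g) x⟫_ℝ =
        -(∫ x, ⟪X k (∂_{EuclideanSpace.single k (1 : ℝ)} f) x, g x⟫_ℝ)
          - ∫ x, ⟪f x, g x⟫_ℝ := by
    have h : ∫ x, ⟪X k f x, (∂_{EuclideanSpace.single k (1 : ℝ)} g) x⟫_ℝ =
        -∫ x, ⟪(∂_{EuclideanSpace.single k (1 : ℝ)} (X k f)) x, g x⟫_ℝ :=
      SchwartzMap.integral_bilinear_lineDerivOp_right_eq_neg_left (X k f) g (innerSL ℝ) _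
    rw [h, neg_sub_left, ← integral_add (integrable_inner_schwartz _ _)
      (integrable_inner_schwartz _ _)]
    congr 2 with x
    rw [lineDeriv_coord_smul, hXa, inner_add_left]
    simp
  calc ∫ x, ⟪f x, radialDeriv g x⟫_ℝ
      = ∫ x, ∑ k, ⟪X k f x, (∂_{EuclideanSpace.single k (1 : ℝ)} g) x⟫_ℝ := by
        congr 1 with x
        simp only [radialDeriv_apply, inner_sum, hXa, real_inner_smul_left, real_inner_smul_right]
    _ = ∑ k, (-(∫ x, ⟪X k (∂_{EuclideanSpace.single k (1 : ℝ)} f) x, g x⟫_ℝ)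
          - ∫ x, ⟪f x, g x⟫_ℝ) := by
        rw [integral_finsetSum _ fun k _ => integrable_inner_schwartz _ _]
        exact Finset.sum_congr rfl fun k _ => hparts k
    _ = -(∫ x, ∑ k, ⟪X k (∂_{EuclideanSpace.single k (1 : ℝ)} f) x, g x⟫_ℝ)
          - d * ∫ x, ⟪f x, g x⟫_ℝ := by
        rw [integral_finsetSum _ fun k _ => integrable_inner_schwartz _ _]
        simp
    _ = _ := by
        congr 3 with x
        simp only [radialDeriv_apply, sum_inner, hXa]

lemma pd2_eq_lineDeriv (u : 𝓢(EuclideanSpace ℝ (Fin d), ℂ)) (j k : Fin d)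
    (x : EuclideanSpace ℝ (Fin d)) :
    pd2 u j k x = (∂_{EuclideanSpace.single j (1 : ℝ)}
      (∂_{EuclideanSpace.single k (1 : ℝ)} u)) x := by
  rw [SchwartzMap.lineDerivOp_apply_eq_fderiv]
  rfl

/-- Applying the radial derivative twice gives the Hessian quadratic form plus a first-order
term. -/
lemma radialDeriv_radialDeriv_apply (u : 𝓢(EuclideanSpace ℝ (Fin d), ℂ))
    (x : EuclideanSpace ℝ (Fin d)) :
    radialDeriv (radialDeriv u) x =
      radialDeriv u x + ∑ j, ∑ k, (x j * x k) • pd2 u j k x := by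
  have h (j : Fin d) : (∂_{EuclideanSpace.single j (1 : ℝ)} (radialDeriv u)) x =
      (∂_{EuclideanSpace.single j (1 : ℝ)} u) x + ∑ k, x k • pd2 u j k x := by
    have : (∂_{EuclideanSpace.single j (1 : ℝ)} (radialDeriv u)) =
        ∑ k, ∂_{EuclideanSpace.single j (1 : ℝ)} (SchwartzMap.smulLeftCLM ℂ
          (fun x : EuclideanSpace ℝ (Fin d) => x k)
          (∂_{EuclideanSpace.single k (1 : ℝ)} u)) :=
      map_sum (LineDeriv.lineDerivOpCLM ℝ 𝓢(EuclideanSpace ℝ (Fin d), ℂ)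
        (EuclideanSpace.single j (1 : ℝ))) _ _
    rw [this, sum_apply]
    simp only [lineDeriv_coord_smul, Finset.sum_add_distrib, pd2_eq_lineDeriv]
    simp
  rw [radialDeriv_apply, radialDeriv_apply u, ← Finset.sum_add_distrib]
  refine Finset.sum_congr rfl fun j _ => ?_
  rw [h, smul_add, Finset.smul_sum]
  simp only [smul_smul]

lemma norm_sum_sum_smul_le (x : EuclideanSpace ℝ (Fin d)) (a : Fin d → Fin d → ℂ) :
    ‖∑ j, ∑ k, (x j * x k) • a j k‖ ≤ ‖x‖ ^ 2 * √(∑ j, ∑ k, ‖a j k‖ ^ 2) := by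
  have hx : ∑ p : Fin d × Fin d, |x p.1 * x p.2| ^ 2 = (‖x‖ ^ 2) ^ 2 := by
    rw [EuclideanSpace.real_norm_sq_eq, sq (∑ i, x i ^ 2), Finset.sum_mul_sum,
      Fintype.sum_prod_type]
    simp only [sq_abs, mul_pow]
  calc ‖∑ j, ∑ k, (x j * x k) • a j k‖
      = ‖∑ p : Fin d × Fin d, (x p.1 * x p.2) • a p.1 p.2‖ := by rw [Fintype.sum_prod_type]
    _ ≤ ∑ p : Fin d × Fin d, |x p.1 * x p.2| * ‖a p.1 p.2‖ := by
        refine (norm_sum_le _ _).trans_eq ?_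
        simp only [norm_smul, Real.norm_eq_abs]
    _ ≤ √(∑ p : Fin d × Fin d, |x p.1 * x p.2| ^ 2) *
          √(∑ p : Fin d × Fin d, ‖a p.1 p.2‖ ^ 2) := Real.sum_mul_le_sqrt_mul_sqrt _ _ _
    _ = _ := by rw [hx, Real.sqrt_sq (by positivity), Fintype.sum_prod_type]

/-- The Cauchy–Schwarz inequality for nonnegative real functions. -/
lemma integral_mul_le_sqrt_mul_sqrt {α : Type*} [MeasurableSpace α] {μ : Measure α} {f g : α → ℝ}
    (hf0 : 0 ≤ f) (hg0 : 0 ≤ g) (hf : MemLp f 2 μ) (hg : MemLp g 2 μ) :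
    ∫ x, f x * g x ∂μ ≤ √(∫ x, f x ^ 2 ∂μ) * √(∫ x, g x ^ 2 ∂μ) := by
  have h := integral_mul_le_Lp_mul_Lq_of_nonneg (μ := μ) Real.HolderConjugate.two_two
    (.of_forall hf0) (.of_forall hg0) (by simpa using hf) (by simpa using hg)
  simpa [Real.sqrt_eq_rpow] using h

lemma integrable_norm_sq_schwartz (f : 𝓢(EuclideanSpace ℝ (Fin d), ℂ)) :
    Integrable (fun x => ‖f x‖ ^ 2) := by
  simpa using integrable_inner_schwartz f f

/-- The weighted interpolation estimate of Step 2 of Section 6.2: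
`∫ |x·∇u|² dx ≤ (d(d+1)/2) ∫ |u|² dx + (∫ |x|⁴|u|² dx)^{1/2} (∫ ‖D²u‖² dx)^{1/2}`,
where `‖D²u(x)‖` is the Frobenius norm of the Hessian of `u` at `x`. -/
theorem weighted_gradient_estimate (hd : 1 ≤ d)
    (u : SchwartzMap (EuclideanSpace ℝ (Fin d)) ℂ) :
    (∫ x, ‖∑ k, (x k : ℂ) * pd (⇑u) k x‖ ^ 2)
      ≤ ((d : ℝ) * (d + 1) / 2) * (∫ x, ‖u x‖ ^ 2)
        + Real.sqrt (∫ x, ‖x‖ ^ 4 * ‖u x‖ ^ 2) *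
            Real.sqrt (∫ x, ∑ j, ∑ k, ‖pd2 (⇑u) j k x‖ ^ 2) := by
  have hR (x) : ∑ k, (x k : ℂ) * pd u k x = radialDeriv u x := by
    simp [radialDeriv_apply, pd, SchwartzMap.lineDerivOp_apply_eq_fderiv]
  set H := radialDeriv (radialDeriv u) - radialDeriv u with hH
  have hHa (x) : H x = ∑ j, ∑ k, (x j * x k) • pd2 u j k x := by
    simp [hH, radialDeriv_radialDeriv_apply]
  set F : EuclideanSpace ℝ (Fin d) → ℝ := fun x => √(∑ j, ∑ k, ‖pd2 u j k x‖ ^ 2) with hF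
  have hF2 (x) : F x ^ 2 = ∑ j, ∑ k, ‖pd2 u j k x‖ ^ 2 := Real.sq_sqrt (by positivity)
  have hFmem : MemLp F 2 volume := by
    have hcont : Continuous F := by
      simp only [hF, pd2_eq_lineDeriv]
      fun_prop
    rw [memLp_two_iff_integrable_sq hcont.aestronglyMeasurable]
    simp only [hF2, pd2_eq_lineDeriv]
    exact integrable_finsetSum _ fun j _ => integrable_finsetSum _ fun k _ =>
      integrable_norm_sq_schwartz _
  have humem : MemLp (fun x => ‖x‖ ^ 2 * ‖u x‖) 2 volume := by
    have h := ((SchwartzMap.smulLeftCLM ℂ (fun x : EuclideanSpace ℝ (Fin d) => ‖x‖ ^ 2)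
      u).memLp 2 volume).norm
    simpa [SchwartzMap.smulLeftCLM_apply (F := ℂ)
      (show (fun x : EuclideanSpace ℝ (Fin d) => ‖x‖ ^ 2).HasTemperateGrowth by fun_prop)] using h
  have h1 := integral_inner_radialDeriv (radialDeriv u) u
  have h2 := integral_inner_radialDeriv u u
  have h3 : ∫ x, ⟪u x, radialDeriv u x⟫_ℝ = ∫ x, ⟪radialDeriv u x, u x⟫_ℝ := by
    simp only [real_inner_comm]
  have h4 : ∫ x, ⟪H x, u x⟫_ℝ = (∫ x, ⟪radialDeriv (radialDeriv u) x, u x⟫_ℝ)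
      - ∫ x, ⟪radialDeriv u x, u x⟫_ℝ := by
    rw [← integral_sub (integrable_inner_schwartz _ _) (integrable_inner_schwartz _ _)]
    simp [hH, inner_sub_left]
  have h5 : -∫ x, ⟪H x, u x⟫_ℝ ≤ ∫ x, (‖x‖ ^ 2 * ‖u x‖) * F x := by
    rw [← integral_neg]
    refine integral_mono (integrable_inner_schwartz _ _).neg (humem.integrable_mul hFmem)
      fun x => ?_
    calc -⟪H x, u x⟫_ℝ ≤ ‖H x‖ * ‖u x‖ :=
          (neg_le_abs _).trans (abs_real_inner_le_norm _ _)
      _ ≤ (‖x‖ ^ 2 * F x) * ‖u x‖ := by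
          gcongr
          rw [hHa]
          exact norm_sum_sum_smul_le x fun j k => pd2 u j k x
      _ = _ := by ring
  have h6 := integral_mul_le_sqrt_mul_sqrt (g := F) (fun x => by positivity)
    (fun x => Real.sqrt_nonneg _) humem hFmem
  simp only [hF2, mul_pow, ← pow_mul, Nat.reduceMul] at h6
  simp only [hR]
  simp only [real_inner_self_eq_norm_sq] at h1 h2
  rw [h3] at h2
  have h7 : ∫ x, ⟪radialDeriv u x, u x⟫_ℝ = -(d / 2) * ∫ x, ‖u x‖ ^ 2 := by linarith
  rw [h7] at h1 h4
  linear_combination h1 + h5 + h6 + h4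
end
end

section
/- Let d ≥ 1 be an integer and let s ∈ [0, 2] be a real number. For all t₁, t₂ ∈ ℝ and every measurable function f : ℝ^d → ℂ, one has ∫_{ℝ^d} (1 + |ξ|²)^s |e^{i t₁ |ξ|²} − e^{i t₂ |ξ|²}|² |f(ξ)|² dξ ≤ 2^s |t₁ − t₂|^{2−s} ∫_{ℝ^d} (1 + |ξ|²)² |f(ξ)|² dξ. -/
open MeasureTheory Complex ENNReal

theorem norm_exp_I_mul_sub_exp_I_mul_le (x y : ℝ) :
    ‖Complex.exp (Complex.I * (x : ℂ)) - Complex.exp (Complex.I * (y : ℂ))‖ ≤ |x - y| := by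
  have h : Complex.exp (Complex.I * (x : ℂ)) - Complex.exp (Complex.I * (y : ℂ)) =
      Complex.exp (Complex.I * (y : ℂ)) * (Complex.exp (Complex.I * ((x - y : ℝ) : ℂ)) - 1) := by
    rw [mul_sub, ← Complex.exp_add, mul_one]
    push_cast
    ring_nf
  rw [h, norm_mul, Complex.norm_exp_I_mul_ofReal, one_mul, ← Real.norm_eq_abs]
  exact Real.norm_exp_I_mul_ofReal_sub_one_le

theorem norm_exp_I_mul_sub_exp_I_mul_le_two (x y : ℝ) :
    ‖Complex.exp (Complex.I * (x : ℂ)) - Complex.exp (Complex.I * (y : ℂ))‖ ≤ 2 := by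
  refine (norm_sub_le _ _).trans ?_
  rw [Complex.norm_exp_I_mul_ofReal, Complex.norm_exp_I_mul_ofReal]
  norm_num

/-- Interpolation between the bounds `n ≤ 2` and `n ≤ b * a`, with weight `a ^ s`. -/
theorem rpow_mul_sq_le_of_le_two_of_le_mul {s n a b : ℝ} (hs0 : 0 ≤ s) (hs2 : s ≤ 2)
    (hn : 0 ≤ n) (ha : 0 < a) (hb : 0 ≤ b) (hn2 : n ≤ 2) (hnab : n ≤ b * a) :
    a ^ s * n ^ 2 ≤ 2 ^ s * b ^ (2 - s) * a ^ 2 := by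
  have hs2' : 0 ≤ 2 - s := sub_nonneg.mpr hs2
  have hsplit : n ^ 2 = n ^ s * n ^ (2 - s) := by
    rw [← Real.rpow_add_of_nonneg hn hs0 hs2', add_sub_cancel, Real.rpow_two]
  have ha2 : a ^ 2 = a ^ s * a ^ (2 - s) := by
    rw [← Real.rpow_add ha, add_sub_cancel, Real.rpow_two]
  calc a ^ s * n ^ 2 = a ^ s * (n ^ s * n ^ (2 - s)) := by rw [hsplit]
    _ ≤ a ^ s * (2 ^ s * (b * a) ^ (2 - s)) := by gcongr
    _ = 2 ^ s * b ^ (2 - s) * a ^ 2 := by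
      rw [Real.mul_rpow hb ha.le, ha2]
      ring

/-- The Fourier-multiplier form of the Hölder continuity estimate (6.6) for the free
Schrödinger group `S(t) = e^{−itΔ}` acting from `H²(ℝ^d)` to `H^s(ℝ^d)`
(Step 3 of Section 6.2): for `0 ≤ s ≤ 2`,
`∫ (1+|ξ|²)^s |e^{it₁|ξ|²} − e^{it₂|ξ|²}|² |f(ξ)|² dξ
  ≤ 2^s |t₁−t₂|^{2−s} ∫ (1+|ξ|²)² |f(ξ)|² dξ`. -/
theorem schroedinger_group_Holder_multiplier_estimate
    {d : ℕ} (hd : 1 ≤ d) {s : ℝ} (hs0 : 0 ≤ s) (hs2 : s ≤ 2) (t₁ t₂ : ℝ)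
    (f : EuclideanSpace ℝ (Fin d) → ℂ) (hf : Measurable f) :
    (∫⁻ ξ, ENNReal.ofReal ((1 + ‖ξ‖ ^ 2) ^ s) *
        (‖Complex.exp (Complex.I * ((t₁ * ‖ξ‖ ^ 2 : ℝ) : ℂ))
            - Complex.exp (Complex.I * ((t₂ * ‖ξ‖ ^ 2 : ℝ) : ℂ))‖₊ : ℝ≥0∞) ^ 2 *
        (‖f ξ‖₊ : ℝ≥0∞) ^ 2)
      ≤ ENNReal.ofReal ((2 : ℝ) ^ s * |t₁ - t₂| ^ (2 - s)) *
          ∫⁻ ξ, ENNReal.ofReal ((1 + ‖ξ‖ ^ 2) ^ 2) * (‖f ξ‖₊ : ℝ≥0∞) ^ 2 := by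
  have hC : 0 ≤ (2 : ℝ) ^ s * |t₁ - t₂| ^ (2 - s) := by positivity
  rw [← lintegral_const_mul' _ _ ENNReal.ofReal_ne_top]
  refine lintegral_mono fun ξ => ?_
  rw [← mul_assoc]
  refine mul_le_mul_left ?_ _
  rw [← enorm_eq_nnnorm, ← ofReal_norm, ← ENNReal.ofReal_pow (norm_nonneg _),
    ← ENNReal.ofReal_mul (by positivity), ← ENNReal.ofReal_mul hC]
  refine ENNReal.ofReal_le_ofReal (rpow_mul_sq_le_of_le_two_of_le_mul hs0 hs2 (norm_nonneg _)
    (by positivity) (abs_nonneg _) (norm_exp_I_mul_sub_exp_I_mul_le_two _ _)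
    ((norm_exp_I_mul_sub_exp_I_mul_le _ _).trans ?_))
  rw [← sub_mul, abs_mul, abs_of_nonneg (sq_nonneg ‖ξ‖)]
  gcongr
  linarith
end

section
/- Let d ≥ 1 be an integer, σ̃ > 0 and λ ≥ 0 real numbers, and T > 0. Let u : ℝ × ℝ^d → ℂ be infinitely differentiable, such that for every multi-index α, every j ∈ {0,1} and every k ∈ ℕ, sup_{t∈[0,T], x∈ℝ^d} (1+|x|)^k |∂_t^j ∂_x^α u(t,x)| < ∞, and such that i ∂_t u(t,x) = Δ_x u(t,x) + λ |u(t,x)|^{2σ̃} u(t,x) for all (t,x) ∈ [0,T] × ℝ^d. Then for every t ∈ [0,T], G(u(t,·)) = G(u(0,·)) + ∫_0^t ( 2 ∫_{ℝ^d} |∇u(s,x)|² dx − (λ σ̃ d/(σ̃+1)) ∫_{ℝ^d} |u(s,x)|^{2σ̃+2} dx ) ds. -/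
open MeasureTheory Complex Filter Topology

noncomputable section

variable {d : ℕ}

/-- The mass `M(v) = ∫ |v|² dx`. -/
def massM (v : EuclideanSpace ℝ (Fin d) → ℂ) : ℝ := ∫ x, ‖v x‖ ^ 2

/-- The energy `H_{σ̃,λ}(v) = (1/2) ∫ |∇v|² dx − (λ/(2σ̃+2)) ∫ |v|^{2σ̃+2} dx`. -/
def energyH (σt lam : ℝ) (v : EuclideanSpace ℝ (Fin d) → ℂ) : ℝ :=
  (1 / 2) * (∫ x, ∑ k, ‖pd v k x‖ ^ 2)
    - (lam / (2 * σt + 2)) * ∫ x, ‖v x‖ ^ (2 * σt + 2)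

/-- The variance `V(v) = ∫ |x|² |v(x)|² dx`. -/
def varV (v : EuclideanSpace ℝ (Fin d) → ℂ) : ℝ := ∫ x, ‖x‖ ^ 2 * ‖v x‖ ^ 2

/-- The momentum `G(v) = Im ∫ v (x·∇v̄) dx`. -/
def momG (v : EuclideanSpace ℝ (Fin d) → ℂ) : ℝ :=
  (∫ x, v x * ∑ k, (x k : ℂ) * (starRingEnd ℂ) (pd v k x)).im

/-- `u`, together with its first time derivative, is rapidly decreasing in space,
uniformly on the time interval `[0, T]`: for every spatial multi-index (encoded via
the order `n` of the iterated spatial derivative), every `j ∈ {0,1}` and every `k`,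
`sup_{t∈[0,T], x} (1+|x|)^k |∂_t^j ∂_x^α u(t,x)| < ∞`. -/
def RapidlyDecreasingOn (T : ℝ) (u : ℝ × EuclideanSpace ℝ (Fin d) → ℂ) : Prop :=
  ∀ n k : ℕ, ∃ C : ℝ, ∀ t ∈ Set.Icc (0 : ℝ) T, ∀ x,
    (1 + ‖x‖) ^ k * ‖iteratedFDeriv ℝ n (fun y => u (t, y)) x‖ ≤ C ∧
    (1 + ‖x‖) ^ k * ‖iteratedFDeriv ℝ n (fun y => deriv (fun s => u (s, y)) t) x‖ ≤ C

/-- `u` is a classical solution on `[0, T]` of the nonlinear Schrödinger equation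
`i ∂_t u = Δu + λ |u|^{2σ̃} u`. -/
def IsNLSSolution (σt lam T : ℝ) (u : ℝ × EuclideanSpace ℝ (Fin d) → ℂ) : Prop :=
  ∀ t ∈ Set.Icc (0 : ℝ) T, ∀ x,
    Complex.I * deriv (fun s => u (s, x)) t
      = lap (fun y => u (t, y)) x
        + ((lam * ‖u (t, x)‖ ^ (2 * σt) : ℝ) : ℂ) * u (t, x)

/-- A continuous function on space-time decaying faster than any power of `‖x‖`, uniformly for
`t ∈ [0, T]`. -/
structure RapidDecay (T : ℝ) (f : ℝ × EuclideanSpace ℝ (Fin d) → ℝ) : Prop where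
  continuous : Continuous f
  bound : ∀ k : ℕ, ∃ C : ℝ, ∀ t ∈ Set.Icc (0 : ℝ) T, ∀ x, (1 + ‖x‖) ^ k * |f (t, x)| ≤ C

namespace RapidDecay

variable {T : ℝ} {f g : ℝ × EuclideanSpace ℝ (Fin d) → ℝ}

lemma zero : RapidDecay T (fun _ : ℝ × EuclideanSpace ℝ (Fin d) => (0 : ℝ)) :=
  ⟨continuous_const, fun _ => ⟨0, fun _ _ _ => by simp⟩⟩

lemma add (hf : RapidDecay T f) (hg : RapidDecay T g) : RapidDecay T (fun p => f p + g p) := by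
  refine ⟨hf.continuous.add hg.continuous, fun k => ?_⟩
  obtain ⟨C, hC⟩ := hf.bound k
  obtain ⟨D, hD⟩ := hg.bound k
  refine ⟨C + D, fun t ht x => ?_⟩
  calc (1 + ‖x‖) ^ k * |f (t, x) + g (t, x)|
      ≤ (1 + ‖x‖) ^ k * (|f (t, x)| + |g (t, x)|) := by gcongr; exact abs_add_le _ _
    _ ≤ C + D := by rw [mul_add]; exact add_le_add (hC t ht x) (hD t ht x)

lemma bounded_mul (hf : Continuous f)
    (hfb : ∃ C : ℝ, ∀ t ∈ Set.Icc (0 : ℝ) T, ∀ x, |f (t, x)| ≤ C)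
    (hg : RapidDecay T g) : RapidDecay T (fun p => f p * g p) := by
  refine ⟨hf.mul hg.continuous, fun k => ?_⟩
  obtain ⟨C, hC⟩ := hfb
  obtain ⟨D, hD⟩ := hg.bound k
  refine ⟨C * D, fun t ht x => ?_⟩
  calc (1 + ‖x‖) ^ k * |f (t, x) * g (t, x)|
      = |f (t, x)| * ((1 + ‖x‖) ^ k * |g (t, x)|) := by rw [abs_mul]; ring
    _ ≤ C * D := mul_le_mul (hC t ht x) (hD t ht x) (by positivity)
        ((abs_nonneg _).trans (hC t ht x))

lemma bounded (hf : RapidDecay T f) :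
    ∃ C : ℝ, ∀ t ∈ Set.Icc (0 : ℝ) T, ∀ x, |f (t, x)| ≤ C := by
  obtain ⟨C, hC⟩ := hf.bound 0
  exact ⟨C, fun t ht x => by simpa using hC t ht x⟩

lemma mul (hf : RapidDecay T f) (hg : RapidDecay T g) : RapidDecay T (fun p => f p * g p) :=
  bounded_mul hf.continuous hf.bounded hg

lemma const_mul (c : ℝ) (hf : RapidDecay T f) : RapidDecay T (fun p => c * f p) :=
  bounded_mul continuous_const ⟨|c|, fun _ _ _ => le_rfl⟩ hf

lemma sub (hf : RapidDecay T f) (hg : RapidDecay T g) : RapidDecay T (fun p => f p - g p) := by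
  simpa [sub_eq_add_neg] using hf.add (hg.const_mul (-1))

lemma sq (hf : RapidDecay T f) : RapidDecay T (fun p => f p ^ 2) := by
  simpa [pow_two] using hf.mul hf

lemma sum {ι : Type*} (s : Finset ι) {F : ι → ℝ × EuclideanSpace ℝ (Fin d) → ℝ}
    (hF : ∀ i, RapidDecay T (F i)) : RapidDecay T (fun p => ∑ i ∈ s, F i p) := by
  classical
  induction s using Finset.induction_on with
  | empty => simpa using zero
  | insert i s hi ih => simpa [Finset.sum_insert hi] using (hF i).add ih

lemma coord_mul (k : Fin d) (hf : RapidDecay T f) : RapidDecay T (fun p => p.2 k * f p) := by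
  refine ⟨by have := hf.continuous; fun_prop, fun n => ?_⟩
  obtain ⟨C, hC⟩ := hf.bound (n + 1)
  refine ⟨C, fun t ht x => (le_trans ?_ (hC t ht x))⟩
  have hx : |x k| ≤ 1 + ‖x‖ := by
    have := PiLp.norm_apply_le x k
    rw [Real.norm_eq_abs] at this
    linarith
  calc (1 + ‖x‖) ^ n * |x k * f (t, x)| = (1 + ‖x‖) ^ n * |x k| * |f (t, x)| := by
        rw [abs_mul]; ring
    _ ≤ (1 + ‖x‖) ^ n * (1 + ‖x‖) * |f (t, x)| := by gcongr
    _ = (1 + ‖x‖) ^ (n + 1) * |f (t, x)| := by ring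

lemma rpow_mul {σ : ℝ} (hσ : 0 ≤ σ) (hf0 : ∀ p, 0 ≤ f p) (hf : RapidDecay T f)
    (hg : RapidDecay T g) : RapidDecay T (fun p => f p ^ σ * g p) := by
  refine bounded_mul (hf.continuous.rpow_const fun _ => Or.inr hσ) ?_ hg
  obtain ⟨C, hC⟩ := hf.bounded
  refine ⟨C ^ σ, fun t ht x => ?_⟩
  rw [abs_of_nonneg (Real.rpow_nonneg (hf0 _) _)]
  exact Real.rpow_le_rpow (hf0 _) ((le_abs_self _).trans (hC t ht x)) hσ

lemma exists_le_rpow (hf : RapidDecay T f) :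
    ∃ C : ℝ, ∀ t ∈ Set.Icc (0 : ℝ) T, ∀ x,
      ‖f (t, x)‖ ≤ C * (1 + ‖x‖) ^ (-((d : ℝ) + 1)) := by
  obtain ⟨C, hC⟩ := hf.bound (d + 1)
  refine ⟨C, fun t ht x => ?_⟩
  have hx : 0 < 1 + ‖x‖ := by positivity
  rw [Real.rpow_neg hx.le, ← div_eq_mul_inv, le_div_iff₀ (by positivity), Real.norm_eq_abs,
    mul_comm]
  exact_mod_cast hC t ht x

lemma integrable_slice (hf : RapidDecay T f) {t : ℝ} (ht : t ∈ Set.Icc (0 : ℝ) T) :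
    Integrable (fun x => f (t, x)) := by
  obtain ⟨C, hC⟩ := hf.exists_le_rpow
  refine ((integrable_one_add_norm (E := EuclideanSpace ℝ (Fin d)) (μ := volume)
    (r := (d : ℝ) + 1) (by simp)).const_mul C).mono' ?_ (Eventually.of_forall fun x => hC t ht x)
  exact (hf.continuous.comp (by fun_prop)).aestronglyMeasurable

lemma integrable_prod (hf : RapidDecay T f) :
    Integrable f ((volume.restrict (Set.Icc (0 : ℝ) T)).prod volume) := by
  obtain ⟨C, hC⟩ := hf.exists_le_rpow
  have h1 : Integrable (fun _ : ℝ => C) (volume.restrict (Set.Icc (0 : ℝ) T)) :=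
    integrable_const C
  refine (h1.mul_prod (integrable_one_add_norm (E := EuclideanSpace ℝ (Fin d)) (μ := volume)
    (r := (d : ℝ) + 1) (by simp))).mono' hf.continuous.aestronglyMeasurable ?_
  have hres : (volume.restrict (Set.Icc (0 : ℝ) T)).prod
      (volume : Measure (EuclideanSpace ℝ (Fin d)))
      = (volume.prod volume).restrict (Set.Icc (0 : ℝ) T ×ˢ Set.univ) := by
    rw [← Measure.prod_restrict, Measure.restrict_univ]
  rw [hres]
  refine (ae_restrict_iff' (measurableSet_Icc.prod MeasurableSet.univ)).2
    (Eventually.of_forall fun p hp => hC p.1 hp.1 p.2)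

/-- The integral of a spatial directional derivative of a rapidly decaying function vanishes. -/
lemma integral_lineDeriv_eq_zero (hf : RapidDecay T f) (hg : RapidDecay T g)
    {v : EuclideanSpace ℝ (Fin d)} (hfg : ∀ p, HasLineDerivAt ℝ f (g p) p (0, v))
    {t : ℝ} (ht : t ∈ Set.Icc (0 : ℝ) T) : ∫ x, g (t, x) = 0 := by
  have h := integral_bilinear_hasLineDerivAt_right_eq_neg_left_of_integrable
    (μ := (volume : Measure (EuclideanSpace ℝ (Fin d)))) (B := ContinuousLinearMap.mul ℝ ℝ)
    (f := fun _ => (1 : ℝ)) (f' := fun _ => 0) (g := fun x => f (t, x))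
    (g' := fun x => g (t, x)) (v := v) (by simp)
    (by simpa using hg.integrable_slice ht) (by simpa using hf.integrable_slice ht)
    (fun x _ => by simpa [HasLineDerivAt] using hasDerivAt_const (0 : ℝ) (1 : ℝ))
    (fun x _ => by simpa [HasLineDerivAt] using hfg (t, x))
  simpa using h

/-- Fundamental theorem of calculus in time, integrated in space. -/
lemma integral_sub_eq_intervalIntegral (hf : RapidDecay T f) (hg : RapidDecay T g)
    (hfg : ∀ p, HasLineDerivAt ℝ f (g p) p (1, 0)) {t : ℝ} (ht : t ∈ Set.Icc (0 : ℝ) T) :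
    ∫ x, f (t, x) = (∫ x, f (0, x)) + ∫ s in (0 : ℝ)..t, ∫ x, g (s, x) := by
  have h0 : (0 : ℝ) ∈ Set.Icc (0 : ℝ) T := ⟨le_rfl, ht.1.trans ht.2⟩
  rw [← sub_eq_iff_eq_add', ← integral_sub (hf.integrable_slice ht) (hf.integrable_slice h0),
    intervalIntegral_integral_swap]
  · congr 1
    ext x
    rw [intervalIntegral.integral_eq_sub_of_hasDerivAt (f := fun s => f (s, x))]
    · intro s _
      have h := hfg (s, x)
      simp only [HasLineDerivAt, Prod.smul_mk, smul_eq_mul, mul_one, smul_zero, Prod.mk_add_mk,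
        add_zero] at h
      have h2 := HasDerivAt.comp_sub_const (x := s) (a := s) (f := fun r => f (s + r, x))
        (f' := g (s, x)) (by simpa using h)
      simpa using h2
    · exact (hg.continuous.comp (by fun_prop)).intervalIntegrable _ _
  · refine hg.integrable_prod.mono_measure (Measure.prod_mono ?_ le_rfl)
    refine Measure.restrict_mono ?_ le_rfl
    rw [Set.uIoc_of_le ht.1]
    exact fun s hs => ⟨hs.1.le, hs.2.trans ht.2⟩

end RapidDecay

/-- The derivative of a space-time function in the direction `v`. -/
def dirDeriv {F : Type*} [NormedAddCommGroup F] [NormedSpace ℝ F]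
    (v : ℝ × EuclideanSpace ℝ (Fin d)) (f : ℝ × EuclideanSpace ℝ (Fin d) → F)
    (p : ℝ × EuclideanSpace ℝ (Fin d)) : F :=
  fderiv ℝ f p v

/-- The time direction in space-time. -/
abbrev timeDir : ℝ × EuclideanSpace ℝ (Fin d) := (1, 0)

/-- The `k`-th spatial direction in space-time. -/
abbrev spaceDir (k : Fin d) : ℝ × EuclideanSpace ℝ (Fin d) := (0, EuclideanSpace.single k 1)

section dirDeriv

variable {F : Type*} [NormedAddCommGroup F] [NormedSpace ℝ F]
  {f : ℝ × EuclideanSpace ℝ (Fin d) → F}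

lemma contDiff_dirDeriv (hf : ContDiff ℝ (⊤ : ℕ∞) f) (v : ℝ × EuclideanSpace ℝ (Fin d)) :
    ContDiff ℝ (⊤ : ℕ∞) (dirDeriv v f) :=
  (hf.fderiv_right (m := (⊤ : ℕ∞)) (by norm_cast)).clm_apply contDiff_const

lemma hasLineDerivAt_dirDeriv (hf : ContDiff ℝ (⊤ : ℕ∞) f)
    (v p : ℝ × EuclideanSpace ℝ (Fin d)) : HasLineDerivAt ℝ f (dirDeriv v f p) p v :=
  ((hf.differentiable (by simp)) p).hasFDerivAt.hasLineDerivAt v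

lemma dirDeriv_comm (hf : ContDiff ℝ (⊤ : ℕ∞) f) (v w p : ℝ × EuclideanSpace ℝ (Fin d)) :
    dirDeriv v (dirDeriv w f) p = dirDeriv w (dirDeriv v f) p := by
  have hd : DifferentiableAt ℝ (fderiv ℝ f) p :=
    (hf.fderiv_right (m := (⊤ : ℕ∞)) (by norm_cast)).differentiable (by simp) p
  have key : ∀ a b : ℝ × EuclideanSpace ℝ (Fin d),
      dirDeriv a (dirDeriv b f) p = fderiv ℝ (fderiv ℝ f) p a b := fun a b => by
    change fderiv ℝ (fun q => fderiv ℝ f q b) p a = _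
    rw [fderiv_clm_apply hd (differentiableAt_const b)]
    simp
  rw [key, key]
  exact (hf.contDiffAt.isSymmSndFDerivAt (by rw [minSmoothness_of_isRCLikeNormedField]; exact WithTop.coe_le_coe.2 le_top)) v w

lemma dirDeriv_clm_comp {G : Type*} [NormedAddCommGroup G] [NormedSpace ℝ G] (L : F →L[ℝ] G)
    (hf : ContDiff ℝ (⊤ : ℕ∞) f) (v : ℝ × EuclideanSpace ℝ (Fin d)) :
    dirDeriv v (fun p => L (f p)) = fun p => L (dirDeriv v f p) := by
  ext p
  have h := L.hasFDerivAt.comp p ((hf.differentiable (by simp)) p).hasFDerivAt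
  change fderiv ℝ (L ∘ f) p v = _
  rw [h.fderiv]
  rfl

lemma fderiv_slice (hf : ContDiff ℝ (⊤ : ℕ∞) f) (t : ℝ) (x e : EuclideanSpace ℝ (Fin d)) :
    fderiv ℝ (fun y => f (t, y)) x e = dirDeriv (0, e) f (t, x) := by
  have h := ((hf.differentiable (by simp)) (t, x)).hasFDerivAt.comp x
    (hasFDerivAt_prodMk_right (𝕜 := ℝ) t x)
  change fderiv ℝ (f ∘ fun y => (t, y)) x e = _
  rw [h.fderiv]
  rfl

lemma deriv_slice (hf : ContDiff ℝ (⊤ : ℕ∞) f) (t : ℝ) (x : EuclideanSpace ℝ (Fin d)) :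
    deriv (fun s => f (s, x)) t = dirDeriv timeDir f (t, x) := by
  have h := ((hf.differentiable (by simp)) (t, x)).hasFDerivAt.comp t
    (hasFDerivAt_prodMk_left (𝕜 := ℝ) t x)
  change fderiv ℝ (f ∘ fun s => (s, x)) t 1 = _
  rw [h.fderiv]
  rfl

end dirDeriv

lemma pd_slice {u : ℝ × EuclideanSpace ℝ (Fin d) → ℂ} (hu : ContDiff ℝ (⊤ : ℕ∞) u) (t : ℝ)
    (k : Fin d) (x : EuclideanSpace ℝ (Fin d)) :
    pd (fun y => u (t, y)) k x = dirDeriv (spaceDir k) u (t, x) :=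
  fderiv_slice hu t x _

lemma pd2_slice {u : ℝ × EuclideanSpace ℝ (Fin d) → ℂ} (hu : ContDiff ℝ (⊤ : ℕ∞) u) (t : ℝ)
    (j k : Fin d) (x : EuclideanSpace ℝ (Fin d)) :
    pd2 (fun y => u (t, y)) j k x
      = dirDeriv (spaceDir j) (dirDeriv (spaceDir k) u) (t, x) := by
  simp only [pd2, fderiv_slice hu, fderiv_slice (contDiff_dirDeriv hu _)]

/-- A smooth real space-time function which decays rapidly together with the derivatives entering
the momentum balance of the Schrödinger equation. -/
structure RapidDecayJet (T : ℝ) (a : ℝ × EuclideanSpace ℝ (Fin d) → ℝ) : Prop where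
  smooth : ContDiff ℝ (⊤ : ℕ∞) a
  self : RapidDecay T a
  space (k : Fin d) : RapidDecay T (dirDeriv (spaceDir k) a)
  space_space (j k : Fin d) : RapidDecay T (dirDeriv (spaceDir j) (dirDeriv (spaceDir k) a))
  time : RapidDecay T (dirDeriv timeDir a)
  space_time (k : Fin d) : RapidDecay T (dirDeriv (spaceDir k) (dirDeriv timeDir a))

lemma RapidDecay.of_clm (L : ℂ →L[ℝ] ℝ) {T : ℝ} {v : ℝ × EuclideanSpace ℝ (Fin d) → ℂ}
    (hv : Continuous v)
    (hb : ∀ k : ℕ, ∃ C : ℝ, ∀ t ∈ Set.Icc (0 : ℝ) T, ∀ x, (1 + ‖x‖) ^ k * ‖v (t, x)‖ ≤ C) :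
    RapidDecay T (fun p => L (v p)) := by
  refine ⟨L.continuous.comp hv, fun k => ?_⟩
  obtain ⟨C, hC⟩ := hb k
  refine ⟨‖L‖ * C, fun t ht x => ?_⟩
  calc (1 + ‖x‖) ^ k * |L (v (t, x))| ≤ (1 + ‖x‖) ^ k * (‖L‖ * ‖v (t, x)‖) := by
        gcongr; exact L.le_opNorm _
    _ = ‖L‖ * ((1 + ‖x‖) ^ k * ‖v (t, x)‖) := by ring
    _ ≤ ‖L‖ * C := by gcongr; exact hC t ht x

lemma RapidlyDecreasingOn.jet {T : ℝ} {u : ℝ × EuclideanSpace ℝ (Fin d) → ℂ}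
    (hu : ContDiff ℝ (⊤ : ℕ∞) u) (h : RapidlyDecreasingOn T u) (L : ℂ →L[ℝ] ℝ) :
    RapidDecayJet T (fun p => L (u p)) := by
  have hone : ∀ (v : ℝ × EuclideanSpace ℝ (Fin d) → ℂ), ContDiff ℝ (⊤ : ℕ∞) v →
      ∀ (k : Fin d) t x, ‖dirDeriv (spaceDir k) v (t, x)‖
        ≤ ‖iteratedFDeriv ℝ 1 (fun y => v (t, y)) x‖ := by
    intro v hv k t x
    rw [← fderiv_slice hv, norm_iteratedFDeriv_one]
    simpa using (fderiv ℝ (fun y => v (t, y)) x).le_opNorm (EuclideanSpace.single k 1)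
  have htwo : ∀ (j k : Fin d) t x,
      ‖dirDeriv (spaceDir j) (dirDeriv (spaceDir k) u) (t, x)‖
        ≤ ‖iteratedFDeriv ℝ 2 (fun y => u (t, y)) x‖ := by
    intro j k t x
    have hd : DifferentiableAt ℝ (fderiv ℝ (fun y => u (t, y))) x :=
      ((hu.comp (contDiff_prodMk_right t)).fderiv_right (m := (⊤ : ℕ∞))
        (by norm_cast)).differentiable (by simp) x
    have h2 := iteratedFDeriv_two_apply (𝕜 := ℝ) (fun y => u (t, y)) x
      ![EuclideanSpace.single j 1, EuclideanSpace.single k 1]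
    have h3 := (iteratedFDeriv ℝ 2 (fun y => u (t, y)) x).le_opNorm
      ![EuclideanSpace.single j 1, EuclideanSpace.single k 1]
    rw [← pd2_slice hu, pd2, fderiv_clm_apply hd (differentiableAt_const _)]
    rw [h2] at h3
    simpa using h3
  have hw : ContDiff ℝ (⊤ : ℕ∞) (dirDeriv timeDir u) := contDiff_dirDeriv hu _
  simp only [RapidlyDecreasingOn, deriv_slice hu] at h
  refine ⟨L.contDiff.comp hu, RapidDecay.of_clm L hu.continuous fun k => ?_, fun k => ?_,
    fun j k => ?_, ?_, fun k => ?_⟩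
  · obtain ⟨C, hC⟩ := h 0 k
    exact ⟨C, fun t ht x => by simpa using (hC t ht x).1⟩
  · rw [dirDeriv_clm_comp L hu]
    refine RapidDecay.of_clm L (contDiff_dirDeriv hu _).continuous fun n => ?_
    obtain ⟨C, hC⟩ := h 1 n
    exact ⟨C, fun t ht x =>
      (mul_le_mul_of_nonneg_left (hone u hu k t x) (by positivity)).trans (hC t ht x).1⟩
  · rw [dirDeriv_clm_comp L hu, dirDeriv_clm_comp L (contDiff_dirDeriv hu _)]
    refine RapidDecay.of_clm L
      (contDiff_dirDeriv (contDiff_dirDeriv hu _) _).continuous fun n => ?_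
    obtain ⟨C, hC⟩ := h 2 n
    exact ⟨C, fun t ht x =>
      (mul_le_mul_of_nonneg_left (htwo j k t x) (by positivity)).trans (hC t ht x).1⟩
  · rw [dirDeriv_clm_comp L hu]
    refine RapidDecay.of_clm L hw.continuous fun n => ?_
    obtain ⟨C, hC⟩ := h 0 n
    exact ⟨C, fun t ht x => by simpa using (hC t ht x).2⟩
  · rw [dirDeriv_clm_comp L hu, dirDeriv_clm_comp L hw]
    refine RapidDecay.of_clm L (contDiff_dirDeriv hw _).continuous fun n => ?_
    obtain ⟨C, hC⟩ := h 1 n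
    exact ⟨C, fun t ht x =>
      (mul_le_mul_of_nonneg_left (hone _ hw k t x) (by positivity)).trans (hC t ht x).2⟩

/-- The momentum density `x · (b ∇a - a ∇b)` of `a + i b`. -/
def momentumDensity (a b : ℝ × EuclideanSpace ℝ (Fin d) → ℝ)
    (p : ℝ × EuclideanSpace ℝ (Fin d)) : ℝ :=
  ∑ k, p.2 k * (b p * dirDeriv (spaceDir k) a p - a p * dirDeriv (spaceDir k) b p)

/-- The time derivative of `momentumDensity`. -/
def momentumDensityDeriv (a b : ℝ × EuclideanSpace ℝ (Fin d) → ℝ)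
    (p : ℝ × EuclideanSpace ℝ (Fin d)) : ℝ :=
  ∑ k, p.2 k *
    ((dirDeriv timeDir b p * dirDeriv (spaceDir k) a p
        + b p * dirDeriv (spaceDir k) (dirDeriv timeDir a) p)
      - (dirDeriv timeDir a p * dirDeriv (spaceDir k) b p
        + a p * dirDeriv (spaceDir k) (dirDeriv timeDir b) p))

/-- The gradient energy density `|∇(a + i b)|²`. -/
def gradSq (a b : ℝ × EuclideanSpace ℝ (Fin d) → ℝ)
    (p : ℝ × EuclideanSpace ℝ (Fin d)) : ℝ :=
  ∑ j, (dirDeriv (spaceDir j) a p ^ 2 + dirDeriv (spaceDir j) b p ^ 2)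

/-- The `k`-th component of the flux in the momentum balance law. -/
def momentumFlux (σ lam : ℝ) (a b : ℝ × EuclideanSpace ℝ (Fin d) → ℝ) (k : Fin d)
    (p : ℝ × EuclideanSpace ℝ (Fin d)) : ℝ :=
  p.2 k * (b p * dirDeriv timeDir a p - a p * dirDeriv timeDir b p)
    - 2 * (dirDeriv (spaceDir k) a p * ∑ j, p.2 j * dirDeriv (spaceDir j) a p
      + dirDeriv (spaceDir k) b p * ∑ j, p.2 j * dirDeriv (spaceDir j) b p)
    + p.2 k * gradSq a b p
    - d * (a p * dirDeriv (spaceDir k) a p + b p * dirDeriv (spaceDir k) b p)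
    - lam / (σ + 1) * (p.2 k * (a p ^ 2 + b p ^ 2) ^ (σ + 1))

/-- The `k`-th spatial derivative of the `k`-th component of `momentumFlux`. -/
def momentumFluxDeriv (σ lam : ℝ) (a b : ℝ × EuclideanSpace ℝ (Fin d) → ℝ) (k : Fin d)
    (p : ℝ × EuclideanSpace ℝ (Fin d)) : ℝ :=
  (b p * dirDeriv timeDir a p - a p * dirDeriv timeDir b p)
    + p.2 k *
      ((dirDeriv (spaceDir k) b p * dirDeriv timeDir a p
          + b p * dirDeriv (spaceDir k) (dirDeriv timeDir a) p)
        - (dirDeriv (spaceDir k) a p * dirDeriv timeDir b p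
          + a p * dirDeriv (spaceDir k) (dirDeriv timeDir b) p))
    - 2 * ((dirDeriv (spaceDir k) (dirDeriv (spaceDir k) a) p
            * ∑ j, p.2 j * dirDeriv (spaceDir j) a p
          + dirDeriv (spaceDir k) a p * (dirDeriv (spaceDir k) a p
            + ∑ j, p.2 j * dirDeriv (spaceDir k) (dirDeriv (spaceDir j) a) p))
        + (dirDeriv (spaceDir k) (dirDeriv (spaceDir k) b) p
            * ∑ j, p.2 j * dirDeriv (spaceDir j) b p
          + dirDeriv (spaceDir k) b p * (dirDeriv (spaceDir k) b p
            + ∑ j, p.2 j * dirDeriv (spaceDir k) (dirDeriv (spaceDir j) b) p)))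
    + (gradSq a b p + p.2 k *
        ∑ j, 2 * (dirDeriv (spaceDir j) a p * dirDeriv (spaceDir k) (dirDeriv (spaceDir j) a) p
          + dirDeriv (spaceDir j) b p * dirDeriv (spaceDir k) (dirDeriv (spaceDir j) b) p))
    - d * ((dirDeriv (spaceDir k) a p ^ 2
            + a p * dirDeriv (spaceDir k) (dirDeriv (spaceDir k) a) p)
        + (dirDeriv (spaceDir k) b p ^ 2
            + b p * dirDeriv (spaceDir k) (dirDeriv (spaceDir k) b) p))
    - lam / (σ + 1) * ((a p ^ 2 + b p ^ 2) ^ (σ + 1)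
        + p.2 k * ((σ + 1) * ((a p ^ 2 + b p ^ 2) ^ σ
          * (2 * (a p * dirDeriv (spaceDir k) a p + b p * dirDeriv (spaceDir k) b p)))))

lemma hasLineDerivAt_momentumDensity {a b : ℝ × EuclideanSpace ℝ (Fin d) → ℝ}
    (ha : ContDiff ℝ (⊤ : ℕ∞) a) (hb : ContDiff ℝ (⊤ : ℕ∞) b)
    (p : ℝ × EuclideanSpace ℝ (Fin d)) :
    HasLineDerivAt ℝ (momentumDensity a b) (momentumDensityDeriv a b p) p timeDir := by
  have hA := hasLineDerivAt_dirDeriv ha timeDir p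
  have hB := hasLineDerivAt_dirDeriv hb timeDir p
  have hAk := fun k => hasLineDerivAt_dirDeriv (contDiff_dirDeriv ha (spaceDir k)) timeDir p
  have hBk := fun k => hasLineDerivAt_dirDeriv (contDiff_dirDeriv hb (spaceDir k)) timeDir p
  simp only [dirDeriv_comm ha timeDir, dirDeriv_comm hb timeDir] at hAk hBk
  unfold HasLineDerivAt at *
  have hX : ∀ k, HasDerivAt (fun r : ℝ => (p + r • (timeDir (d := d))).2 k) 0 0 := fun k => by
    simpa using hasDerivAt_const (0 : ℝ) (p.2 k)
  refine (HasDerivAt.fun_sum fun k _ =>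
    (hX k).mul ((hB.mul (hAk k)).sub (hA.mul (hBk k)))).congr_deriv ?_
  simp [momentumDensityDeriv]

lemma hasLineDerivAt_momentumFlux {σ : ℝ} (hσ : 0 ≤ σ) (lam : ℝ)
    {a b : ℝ × EuclideanSpace ℝ (Fin d) → ℝ}
    (ha : ContDiff ℝ (⊤ : ℕ∞) a) (hb : ContDiff ℝ (⊤ : ℕ∞) b) (k : Fin d)
    (p : ℝ × EuclideanSpace ℝ (Fin d)) :
    HasLineDerivAt ℝ (momentumFlux σ lam a b k) (momentumFluxDeriv σ lam a b k p) p
      (spaceDir k) := by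
  have hA := hasLineDerivAt_dirDeriv ha (spaceDir k) p
  have hB := hasLineDerivAt_dirDeriv hb (spaceDir k) p
  have hAt := hasLineDerivAt_dirDeriv (contDiff_dirDeriv ha timeDir) (spaceDir k) p
  have hBt := hasLineDerivAt_dirDeriv (contDiff_dirDeriv hb timeDir) (spaceDir k) p
  have hAj := fun j => hasLineDerivAt_dirDeriv (contDiff_dirDeriv ha (spaceDir j)) (spaceDir k) p
  have hBj := fun j => hasLineDerivAt_dirDeriv (contDiff_dirDeriv hb (spaceDir j)) (spaceDir k) p
  unfold HasLineDerivAt at *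
  have hX : ∀ j, HasDerivAt (fun r : ℝ => (p + r • (spaceDir k)).2 j)
      (if j = k then 1 else 0) 0 := fun j => by
    by_cases h : j = k
    · simpa [h] using (hasDerivAt_id (0 : ℝ)).const_add (p.2 k)
    · simpa [h] using hasDerivAt_const (0 : ℝ) (p.2 j)
  have hS : HasDerivAt (fun r : ℝ =>
        (a (p + r • spaceDir k) ^ 2 + b (p + r • spaceDir k) ^ 2) ^ (σ + 1))
      ((σ + 1) * ((a p ^ 2 + b p ^ 2) ^ σ
        * (2 * (a p * dirDeriv (spaceDir k) a p + b p * dirDeriv (spaceDir k) b p)))) 0 := by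
    refine (((hA.fun_pow 2).fun_add (hB.fun_pow 2)).rpow_const (p := σ + 1)
      (Or.inr (by linarith))).congr_deriv ?_
    simp only [zero_smul, add_zero, add_sub_cancel_right]
    push_cast
    ring
  have hG : HasDerivAt (fun r : ℝ => gradSq a b (p + r • spaceDir k))
      (∑ j, 2 * (dirDeriv (spaceDir j) a p * dirDeriv (spaceDir k) (dirDeriv (spaceDir j) a) p
        + dirDeriv (spaceDir j) b p * dirDeriv (spaceDir k) (dirDeriv (spaceDir j) b) p)) 0 := by
    refine (HasDerivAt.fun_sum fun j _ =>
      ((hAj j).fun_pow 2).fun_add ((hBj j).fun_pow 2)).congr_deriv ?_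
    refine Finset.sum_congr rfl fun j _ => ?_
    simp only [zero_smul, add_zero]
    push_cast
    ring
  have hM : ∀ (c : Fin d → ℝ × EuclideanSpace ℝ (Fin d) → ℝ) (c' : Fin d → ℝ),
      (∀ j, HasDerivAt (fun r : ℝ => c j (p + r • spaceDir k)) (c' j) 0) →
      HasDerivAt (fun r : ℝ => ∑ j, (p + r • spaceDir k).2 j * c j (p + r • spaceDir k))
        (c k p + ∑ j, p.2 j * c' j) 0 := fun c c' hc => by
    refine (HasDerivAt.fun_sum fun j _ => (hX j).fun_mul (hc j)).congr_deriv ?_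
    simp [Finset.sum_add_distrib]
  refine ((((((hX k).fun_mul ((hB.fun_mul hAt).fun_sub (hA.fun_mul hBt))).fun_sub
    ((((hAj k).fun_mul (hM _ _ hAj)).fun_add ((hBj k).fun_mul (hM _ _ hBj))).const_mul 2)).fun_add
    ((hX k).fun_mul hG)).fun_sub
    (((hA.fun_mul (hAj k)).fun_add (hB.fun_mul (hBj k))).const_mul (d : ℝ))).fun_sub
    (((hX k).fun_mul hS).const_mul (lam / (σ + 1)))).congr_deriv ?_
  simp only [momentumFluxDeriv, zero_smul, add_zero, if_true]
  ring

lemma RapidDecayJet.momentumDensity {T : ℝ} {a b : ℝ × EuclideanSpace ℝ (Fin d) → ℝ}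
    (ha : RapidDecayJet T a) (hb : RapidDecayJet T b) : RapidDecay T (momentumDensity a b) :=
  RapidDecay.sum _ fun k =>
    ((hb.self.mul (ha.space k)).sub (ha.self.mul (hb.space k))).coord_mul k

lemma RapidDecayJet.momentumDensityDeriv {T : ℝ} {a b : ℝ × EuclideanSpace ℝ (Fin d) → ℝ}
    (ha : RapidDecayJet T a) (hb : RapidDecayJet T b) :
    RapidDecay T (momentumDensityDeriv a b) :=
  RapidDecay.sum _ fun k =>
    (((hb.time.mul (ha.space k)).add (hb.self.mul (ha.space_time k))).sub
      ((ha.time.mul (hb.space k)).add (ha.self.mul (hb.space_time k)))).coord_mul k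

lemma RapidDecayJet.gradSq {T : ℝ} {a b : ℝ × EuclideanSpace ℝ (Fin d) → ℝ}
    (ha : RapidDecayJet T a) (hb : RapidDecayJet T b) : RapidDecay T (gradSq a b) :=
  RapidDecay.sum _ fun j => (ha.space j).sq.add (hb.space j).sq

lemma RapidDecayJet.sq_add_sq_rpow {T σ : ℝ} (hσ : 0 ≤ σ)
    {a b : ℝ × EuclideanSpace ℝ (Fin d) → ℝ}
    (ha : RapidDecayJet T a) (hb : RapidDecayJet T b) :
    RapidDecay T (fun p => (a p ^ 2 + b p ^ 2) ^ (σ + 1)) := by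
  have hS := ha.self.sq.add hb.self.sq
  have hS0 : ∀ p, 0 ≤ a p ^ 2 + b p ^ 2 := fun p => by positivity
  convert hS.rpow_mul hσ hS0 hS using 2 with p
  rw [Real.rpow_add_one' (hS0 p) (by linarith)]

lemma RapidDecayJet.momentumFlux {T σ : ℝ} (hσ : 0 ≤ σ) (lam : ℝ)
    {a b : ℝ × EuclideanSpace ℝ (Fin d) → ℝ}
    (ha : RapidDecayJet T a) (hb : RapidDecayJet T b) (k : Fin d) :
    RapidDecay T (momentumFlux σ lam a b k) := by
  have hM : ∀ {c : ℝ × EuclideanSpace ℝ (Fin d) → ℝ}, RapidDecayJet T c →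
      RapidDecay T (fun p => ∑ j, p.2 j * dirDeriv (spaceDir j) c p) := fun hc =>
    RapidDecay.sum _ fun j => (hc.space j).coord_mul j
  exact ((((((hb.self.mul ha.time).sub (ha.self.mul hb.time)).coord_mul k).sub
    ((((ha.space k).mul (hM ha)).add ((hb.space k).mul (hM hb))).const_mul 2)).add
    ((ha.gradSq hb).coord_mul k)).sub
    (((ha.self.mul (ha.space k)).add (hb.self.mul (hb.space k))).const_mul d)).sub
    (((ha.sq_add_sq_rpow hσ hb).coord_mul k).const_mul (lam / (σ + 1)))

lemma RapidDecayJet.momentumFluxDeriv {T σ : ℝ} (hσ : 0 ≤ σ) (lam : ℝ)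
    {a b : ℝ × EuclideanSpace ℝ (Fin d) → ℝ}
    (ha : RapidDecayJet T a) (hb : RapidDecayJet T b) (k : Fin d) :
    RapidDecay T (momentumFluxDeriv σ lam a b k) := by
  have hM : ∀ {c : ℝ × EuclideanSpace ℝ (Fin d) → ℝ}, RapidDecayJet T c →
      RapidDecay T (fun p => ∑ j, p.2 j * dirDeriv (spaceDir j) c p) := fun hc =>
    RapidDecay.sum _ fun j => (hc.space j).coord_mul j
  have hN : ∀ {c : ℝ × EuclideanSpace ℝ (Fin d) → ℝ}, RapidDecayJet T c →
      RapidDecay T (fun p => ∑ j, p.2 j * dirDeriv (spaceDir k) (dirDeriv (spaceDir j) c) p) :=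
    fun hc => RapidDecay.sum _ fun j => (hc.space_space k j).coord_mul j
  have hS := ha.self.sq.add hb.self.sq
  have hS0 : ∀ p, 0 ≤ a p ^ 2 + b p ^ 2 := fun p => by positivity
  have hP := (((ha.self.mul (ha.space k)).add (hb.self.mul (hb.space k))).const_mul 2)
  exact (((((((hb.self.mul ha.time).sub (ha.self.mul hb.time)).add
    ((((((hb.space k).mul ha.time).add (hb.self.mul (ha.space_time k))).sub
      (((ha.space k).mul hb.time).add (ha.self.mul (hb.space_time k)))).coord_mul k))).sub
    (((((ha.space_space k k).mul (hM ha)).add ((ha.space k).mul ((ha.space k).add (hN ha)))).add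
      (((hb.space_space k k).mul (hM hb)).add
        ((hb.space k).mul ((hb.space k).add (hN hb))))).const_mul 2)).add
    ((ha.gradSq hb).add ((RapidDecay.sum _ fun j =>
      ((((ha.space j).mul (ha.space_space k j)).add
        ((hb.space j).mul (hb.space_space k j))).const_mul 2)).coord_mul k))).sub
    ((((ha.space k).sq.add (ha.self.mul (ha.space_space k k))).add
      ((hb.space k).sq.add (hb.self.mul (hb.space_space k k)))).const_mul d)).sub
    (((ha.sq_add_sq_rpow hσ hb).add
      (((hS.rpow_mul hσ hS0 hP).const_mul (σ + 1)).coord_mul k)).const_mul (lam / (σ + 1))))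

/-- The pointwise momentum balance law for the nonlinear Schrödinger equation, written in terms
of the real and imaginary parts of the solution. -/
lemma momentumDensityDeriv_eq {σ lam : ℝ} (hσ : 0 < σ)
    {a b : ℝ × EuclideanSpace ℝ (Fin d) → ℝ}
    (ha : ContDiff ℝ (⊤ : ℕ∞) a) (hb : ContDiff ℝ (⊤ : ℕ∞) b)
    {p : ℝ × EuclideanSpace ℝ (Fin d)}
    (hre : -dirDeriv timeDir b p = (∑ k, dirDeriv (spaceDir k) (dirDeriv (spaceDir k) a) p)
      + lam * (a p ^ 2 + b p ^ 2) ^ σ * a p)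
    (him : dirDeriv timeDir a p = (∑ k, dirDeriv (spaceDir k) (dirDeriv (spaceDir k) b) p)
      + lam * (a p ^ 2 + b p ^ 2) ^ σ * b p) :
    momentumDensityDeriv a b p = (∑ k, momentumFluxDeriv σ lam a b k p)
      + (2 * gradSq a b p - lam * σ * d / (σ + 1) * (a p ^ 2 + b p ^ 2) ^ (σ + 1)) := by
  have hdens : ∀ x A B ra rb : Fin d → ℝ, ∀ a b wa wb : ℝ,
      ∑ k, x k * ((wb * A k + b * ra k) - (wa * B k + a * rb k))
        = wb * (∑ k, x k * A k) + b * (∑ k, x k * ra k)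
          - wa * (∑ k, x k * B k) - a * (∑ k, x k * rb k) := by
    intro x A B ra rb a b wa wb
    simp only [Finset.mul_sum, ← Finset.sum_add_distrib, ← Finset.sum_sub_distrib]
    exact Finset.sum_congr rfl fun k _ => by ring
  have hflux : ∀ x A B ra rb La Lb Ma Mb K : Fin d → ℝ,
      ∀ a b wa wb Xa Xb G P S c D : ℝ,
      ∑ k, ((b * wa - a * wb)
          + x k * ((B k * wa + b * ra k) - (A k * wb + a * rb k))
          - 2 * ((La k * Xa + A k * (A k + Ma k)) + (Lb k * Xb + B k * (B k + Mb k)))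
          + (G + x k * K k)
          - D * ((A k ^ 2 + a * La k) + (B k ^ 2 + b * Lb k))
          - c * (S + x k * ((σ + 1) * (P * (2 * (a * A k + b * B k))))))
        = d * (b * wa - a * wb + G - c * S)
          + wa * (∑ k, x k * B k) + b * (∑ k, x k * ra k)
          - wb * (∑ k, x k * A k) - a * (∑ k, x k * rb k)
          - 2 * (Xa * (∑ k, La k) + Xb * (∑ k, Lb k) + (∑ k, (A k ^ 2 + B k ^ 2))
            + (∑ k, A k * Ma k) + (∑ k, B k * Mb k))
          + (∑ k, x k * K k)
          - D * ((∑ k, (A k ^ 2 + B k ^ 2)) + a * (∑ k, La k) + b * (∑ k, Lb k))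
          - c * (σ + 1) * P * 2 * (a * (∑ k, x k * A k) + b * (∑ k, x k * B k)) := by
    intro x A B ra rb La Lb Ma Mb K a b wa wb Xa Xb G P S c D
    have hconst : d * (b * wa - a * wb + G - c * S)
        = ∑ _k : Fin d, (b * wa - a * wb + G - c * S) := by
      rw [Finset.sum_const, Finset.card_univ, Fintype.card_fin, nsmul_eq_mul]
    rw [hconst]
    simp only [Finset.mul_sum, ← Finset.sum_add_distrib, ← Finset.sum_sub_distrib]
    exact Finset.sum_congr rfl fun k _ => by ring
  have hcross : ∑ k, p.2 k * ∑ j, 2 *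
        (dirDeriv (spaceDir j) a p * dirDeriv (spaceDir k) (dirDeriv (spaceDir j) a) p
          + dirDeriv (spaceDir j) b p * dirDeriv (spaceDir k) (dirDeriv (spaceDir j) b) p)
      = 2 * ((∑ k, dirDeriv (spaceDir k) a p
            * ∑ j, p.2 j * dirDeriv (spaceDir k) (dirDeriv (spaceDir j) a) p)
          + ∑ k, dirDeriv (spaceDir k) b p
            * ∑ j, p.2 j * dirDeriv (spaceDir k) (dirDeriv (spaceDir j) b) p) := by
    simp only [Finset.mul_sum, ← Finset.sum_add_distrib]
    rw [Finset.sum_comm]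
    refine Finset.sum_congr rfl fun k _ => Finset.sum_congr rfl fun j _ => ?_
    rw [dirDeriv_comm ha (spaceDir j), dirDeriv_comm hb (spaceDir j)]
    ring
  have hS : (a p ^ 2 + b p ^ 2) ^ (σ + 1) = (a p ^ 2 + b p ^ 2) ^ σ * (a p ^ 2 + b p ^ 2) :=
    Real.rpow_add_one' (by positivity) (by linarith)
  have hLa := eq_sub_of_add_eq hre.symm
  have hLb := eq_sub_of_add_eq him.symm
  have hσ1 : σ + 1 ≠ 0 := by positivity
  simp only [momentumDensityDeriv, momentumFluxDeriv]
  rw [hdens, hflux, hcross, hLa, hLb, hS, gradSq]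
  field_simp
  ring

/-- The momentum balance law integrated in space. -/
lemma RapidDecayJet.integral_momentumDensityDeriv {σ lam T : ℝ} (hσ : 0 < σ)
    {a b : ℝ × EuclideanSpace ℝ (Fin d) → ℝ}
    (ha : RapidDecayJet T a) (hb : RapidDecayJet T b) {t : ℝ} (ht : t ∈ Set.Icc (0 : ℝ) T)
    (hre : ∀ x, -dirDeriv timeDir b (t, x)
      = (∑ k, dirDeriv (spaceDir k) (dirDeriv (spaceDir k) a) (t, x))
        + lam * (a (t, x) ^ 2 + b (t, x) ^ 2) ^ σ * a (t, x))
    (him : ∀ x, dirDeriv timeDir a (t, x)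
      = (∑ k, dirDeriv (spaceDir k) (dirDeriv (spaceDir k) b) (t, x))
        + lam * (a (t, x) ^ 2 + b (t, x) ^ 2) ^ σ * b (t, x)) :
    ∫ x, _root_.momentumDensityDeriv a b (t, x)
      = 2 * (∫ x, _root_.gradSq a b (t, x))
        - lam * σ * d / (σ + 1) * ∫ x, (a (t, x) ^ 2 + b (t, x) ^ 2) ^ (σ + 1) := by
  have hflux := fun k => (ha.momentumFluxDeriv hσ.le lam hb k)
  have hzero : ∀ k, ∫ x, _root_.momentumFluxDeriv σ lam a b k (t, x) = 0 := fun k =>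
    (ha.momentumFlux hσ.le lam hb k).integral_lineDeriv_eq_zero (hflux k)
      (hasLineDerivAt_momentumFlux hσ.le lam ha.smooth hb.smooth k) ht
  have hG := (ha.gradSq hb).integrable_slice ht
  have hP := (ha.sq_add_sq_rpow hσ.le hb).integrable_slice ht
  simp only [fun x => momentumDensityDeriv_eq hσ ha.smooth hb.smooth (hre x) (him x)]
  rw [integral_add (integrable_finsetSum _ fun k _ => (hflux k).integrable_slice ht)
    (by exact (hG.const_mul 2).sub (hP.const_mul _)),
    integral_finsetSum _ fun k _ => (hflux k).integrable_slice ht,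
    integral_sub (hG.const_mul 2) (hP.const_mul _), integral_const_mul, integral_const_mul]
  simp [hzero]

/-- The deterministic content of identity (3.3) of Proposition 3.2 for classical
Schwartz-valued solutions:
`G(u(t)) = G(u(0)) + ∫₀ᵗ (2 ∫|∇u(s)|² dx − (λσ̃d/(σ̃+1)) ∫|u(s)|^{2σ̃+2} dx) ds`. -/
theorem momentum_identity_NLS
    (hd : 1 ≤ d) {σt lam : ℝ} (hσt : 0 < σt) (hlam : 0 ≤ lam) {T : ℝ} (hT : 0 < T)
    (u : ℝ × EuclideanSpace ℝ (Fin d) → ℂ)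
    (hu_smooth : ContDiff ℝ (⊤ : ℕ∞) u)
    (hu_decay : RapidlyDecreasingOn T u)
    (hu_eq : IsNLSSolution σt lam T u) :
    ∀ t ∈ Set.Icc (0 : ℝ) T,
      momG (fun y => u (t, y))
        = momG (fun y => u (0, y))
          + ∫ s in (0 : ℝ)..t,
              (2 * (∫ x, ∑ k, ‖pd (fun y => u (s, y)) k x‖ ^ 2)
                - (lam * σt * d / (σt + 1)) * ∫ x, ‖u (s, x)‖ ^ (2 * σt + 2)) := by
  intro t ht
  set a : ℝ × EuclideanSpace ℝ (Fin d) → ℝ := fun p => reCLM (u p)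
  set b : ℝ × EuclideanSpace ℝ (Fin d) → ℝ := fun p => imCLM (u p)
  have ha : RapidDecayJet T a := hu_decay.jet hu_smooth reCLM
  have hb : RapidDecayJet T b := hu_decay.jet hu_smooth imCLM
  have haE : ∀ p, a p = (u p).re := fun _ => rfl
  have hbE : ∀ p, b p = (u p).im := fun _ => rfl
  have hDa : ∀ v p, dirDeriv v a p = (dirDeriv v u p).re := fun v p =>
    congrFun (dirDeriv_clm_comp reCLM hu_smooth v) p
  have hDb : ∀ v p, dirDeriv v b p = (dirDeriv v u p).im := fun v p =>
    congrFun (dirDeriv_clm_comp imCLM hu_smooth v) p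
  have hDDa : ∀ v w p, dirDeriv v (dirDeriv w a) p = (dirDeriv v (dirDeriv w u) p).re :=
    fun v w p => by
      rw [dirDeriv_clm_comp reCLM hu_smooth w,
        dirDeriv_clm_comp reCLM (contDiff_dirDeriv hu_smooth w) v]
      rfl
  have hDDb : ∀ v w p, dirDeriv v (dirDeriv w b) p = (dirDeriv v (dirDeriv w u) p).im :=
    fun v w p => by
      rw [dirDeriv_clm_comp imCLM hu_smooth w,
        dirDeriv_clm_comp imCLM (contDiff_dirDeriv hu_smooth w) v]
      rfl
  have hnorm : ∀ z : ℂ, ∀ r : ℝ, ‖z‖ ^ (2 * r) = (z.re ^ 2 + z.im ^ 2) ^ r := fun z r => by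
    rw [Real.rpow_mul (norm_nonneg z), Real.rpow_two, ← normSq_eq_norm_sq, normSq_apply]
    ring_nf
  have hmom : ∀ s ∈ Set.Icc (0 : ℝ) T,
      momG (fun y => u (s, y)) = ∫ x, momentumDensity a b (s, x) := by
    intro s hs
    have him : ∀ x, (u (s, x) * ∑ k, (x k : ℂ) * starRingEnd ℂ (pd (fun y => u (s, y)) k x)).im
        = momentumDensity a b (s, x) := fun x => by
      simp only [pd_slice hu_smooth, momentumDensity, hDa, hDb, Finset.mul_sum, im_sum]
      refine Finset.sum_congr rfl fun k _ => ?_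
      simp [haE, hbE]
      ring
    have hre : ∀ x, (u (s, x) * ∑ k, (x k : ℂ) * starRingEnd ℂ (pd (fun y => u (s, y)) k x)).re
        = ∑ k, x k * (a (s, x) * dirDeriv (spaceDir k) a (s, x)
          + b (s, x) * dirDeriv (spaceDir k) b (s, x)) := fun x => by
      simp only [pd_slice hu_smooth, hDa, hDb, Finset.mul_sum, re_sum]
      refine Finset.sum_congr rfl fun k _ => ?_
      simp [haE, hbE]
      ring
    have hint : Integrable fun x =>
        u (s, x) * ∑ k, (x k : ℂ) * starRingEnd ℂ (pd (fun y => u (s, y)) k x) := by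
      refine Integrable.re_im_iff.1 ⟨?_, ?_⟩
      · simp only [RCLike.re_eq_complex_re, hre]
        exact (RapidDecay.sum Finset.univ fun k => ((ha.self.mul (ha.space k)).add
          (hb.self.mul (hb.space k))).coord_mul k).integrable_slice hs
      · simp only [RCLike.im_eq_complex_im, him]
        exact (ha.momentumDensity hb).integrable_slice hs
    rw [momG, ← imCLM_apply, ← imCLM.integral_comp_comm hint]
    simp only [imCLM_apply, him]
  have heq : ∀ s ∈ Set.Icc (0 : ℝ) T, ∀ x,
      I * dirDeriv timeDir u (s, x)
        = (∑ k, dirDeriv (spaceDir k) (dirDeriv (spaceDir k) u) (s, x))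
          + ((lam * (a (s, x) ^ 2 + b (s, x) ^ 2) ^ σt : ℝ) : ℂ) * u (s, x) := by
    intro s hs x
    have h := hu_eq s hs x
    rw [deriv_slice hu_smooth, hnorm] at h
    simpa only [lap, pd2_slice hu_smooth, haE, hbE] using h
  rw [hmom t ht, hmom 0 ⟨le_rfl, hT.le⟩,
    (ha.momentumDensity hb).integral_sub_eq_intervalIntegral (ha.momentumDensityDeriv hb)
      (hasLineDerivAt_momentumDensity ha.smooth hb.smooth) ht]
  congr 1
  refine intervalIntegral.integral_congr fun s hs => ?_
  rw [Set.uIcc_of_le ht.1] at hs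
  have hs' : s ∈ Set.Icc (0 : ℝ) T := ⟨hs.1, hs.2.trans ht.2⟩
  have h1 : ∀ x, ∑ k, ‖pd (fun y => u (s, y)) k x‖ ^ 2 = gradSq a b (s, x) := fun x => by
    refine Finset.sum_congr rfl fun k _ => ?_
    rw [pd_slice hu_smooth, hDa, hDb, ← normSq_eq_norm_sq, normSq_apply]
    ring
  have h2 : ∀ x, ‖u (s, x)‖ ^ (2 * σt + 2) = (a (s, x) ^ 2 + b (s, x) ^ 2) ^ (σt + 1) := by
    intro x
    rw [show 2 * σt + 2 = 2 * (σt + 1) by ring, hnorm]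
    rfl
  simp only [h1, h2]
  refine ha.integral_momentumDensityDeriv hσt hb hs' (fun x => ?_) (fun x => ?_)
  · have h := congrArg re (heq s hs' x)
    simpa [hDa, hDb, hDDa, hDDb, haE, hbE, re_sum] using h
  · have h := congrArg im (heq s hs' x)
    simpa [hDa, hDb, hDDa, hDDb, haE, hbE, im_sum] using h
end
end
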